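/- arXiv:2405.06679 — 2 statements merged into one kernel-verified Lean document; each statement's English description precedes it below -/
import Mathlib

section
/- For m > 1 and σ > 0, the space Y_σ^m(Π) of partially-analytic functions on the periodic strip Π = T × [0,1] is a Banach algebra: there is a constant C such that ‖ab‖_{Y_σ^m} ≤ C ‖a‖_{Y_σ^m} ‖b‖_{Y_σ^m} for all a, b ∈ Y_σ^m(Π). -/
open MeasureTheory
open scoped ENNReal NNReal

/- STATEMENT 6: For m > 1 and σ > 0, Y_σ^m(Π) is a Banach algebra:
‖ab‖_{Y_σ^m} ≤ C ‖a‖_{Y_σ^m} ‖b‖_{Y_σ^m}.  An element of Y_σ^m(Π) is given by its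
family of Fourier coefficient functions â_k : [0,1] → ℂ, with
‖a‖² = Σ_{p+q≤m} Σ_k k^{2q} e^{2σ|k|} ‖D^p â_k‖²_{L²(0,1)}; the product of two
elements has coefficients given by convolution. -/

/-- squared Y_σ^m norm of a = Σ_k â_k(ψ)e^{ikx}, given via coefficients â -/
noncomputable def YcSq (σ : ℝ) (m : ℕ) (a : ℤ → ℝ → ℂ) : ℝ≥0∞ :=
  ∑ p ∈ Finset.range (m+1), ∑ q ∈ Finset.range (m+1-p),
    ∑' k : ℤ, ENNReal.ofReal ((k:ℝ)^(2*q) * Real.exp (2*σ*|(k:ℝ)|)) *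
      ∫⁻ t in Set.Icc (0:ℝ) 1, (‖iteratedDeriv p (a k) t‖₊ : ℝ≥0∞)^2

/-- Fourier coefficients of the pointwise product ab (convolution) -/
noncomputable def conv (a b : ℤ → ℝ → ℂ) (k : ℤ) (t : ℝ) : ℂ :=
  ∑' j : ℤ, a j t * b (k - j) t

/-- Cauchy–Schwarz for `ℝ≥0∞`-valued functions. -/
lemma lintegral_mul_sq_le {α : Type*} [MeasurableSpace α] {μ : Measure α} {f g : α → ℝ≥0∞}
    (hf : AEMeasurable f μ) (hg : AEMeasurable g μ) :
    (∫⁻ x, f x * g x ∂μ) ^ 2 ≤ (∫⁻ x, f x ^ 2 ∂μ) * ∫⁻ x, g x ^ 2 ∂μ := by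
  have h := ENNReal.lintegral_mul_le_Lp_mul_Lq μ Real.HolderConjugate.two_two hf hg
  simp only [Pi.mul_apply, ENNReal.rpow_two] at h
  have hsq (x : ℝ≥0∞) : (x ^ (1 / 2 : ℝ)) ^ 2 = x := by
    rw [← ENNReal.rpow_natCast, ← ENNReal.rpow_mul]
    norm_num
  calc _ ≤ _ := pow_le_pow_left' h 2
    _ = _ := by rw [mul_pow, hsq, hsq]

/-- Cauchy–Schwarz for series in `ℝ≥0∞`. -/
lemma tsum_mul_sq_le {ι : Type*} (f g : ι → ℝ≥0∞) :
    (∑' i, f i * g i) ^ 2 ≤ (∑' i, f i ^ 2) * ∑' i, g i ^ 2 := by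
  let _ : MeasurableSpace ι := ⊤
  simpa only [lintegral_count] using
    lintegral_mul_sq_le (μ := Measure.count) (f := f) (g := g)
      measurable_from_top.aemeasurable measurable_from_top.aemeasurable

lemma ennreal_add_sq_le (x y : ℝ≥0∞) : (x + y) ^ 2 ≤ 2 * (x ^ 2 + y ^ 2) := by
  have h := ENNReal.rpow_add_le_mul_rpow_add_rpow x y (p := 2) (by norm_num)
  norm_num at h
  exact h

lemma ennreal_mul_le_sq_add_sq (x y : ℝ≥0∞) : x * y ≤ x ^ 2 + y ^ 2 := by
  rcases le_total x y with h | h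
  · calc x * y ≤ y ^ 2 := by rw [sq]; gcongr
      _ ≤ _ := le_add_self
  · calc x * y ≤ x ^ 2 := by rw [sq]; gcongr
      _ ≤ _ := le_self_add

lemma ennreal_sum_sq_le {ι : Type*} (s : Finset ι) (f : ι → ℝ≥0∞) :
    (∑ i ∈ s, f i) ^ 2 ≤ s.card * ∑ i ∈ s, f i ^ 2 := by
  have h := ENNReal.rpow_sum_le_const_mul_sum_rpow s f (p := 2) (by norm_num)
  norm_num at h
  exact h

lemma enorm_sub_le_lintegral_deriv {h : ℝ → ℂ} (hh : ContDiff ℝ 1 h) {s t : ℝ}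
    (hs : s ∈ Set.Icc (0 : ℝ) 1) (ht : t ∈ Set.Icc (0 : ℝ) 1) :
    ‖h t - h s‖ₑ ≤ ∫⁻ x in Set.Icc (0 : ℝ) 1, ‖deriv h x‖ₑ := by
  rw [← intervalIntegral.integral_deriv_eq_sub
    (fun x _ => (hh.differentiable (by norm_num)).differentiableAt)
    ((hh.continuous_deriv le_rfl).intervalIntegrable s t)]
  calc ‖∫ x in s..t, deriv h x‖ₑ = ‖∫ x in Set.uIoc s t, deriv h x‖ₑ := by
        rw [← ofReal_norm, ← ofReal_norm, intervalIntegral.norm_intervalIntegral_eq]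
    _ ≤ ∫⁻ x in Set.uIoc s t, ‖deriv h x‖ₑ := enorm_integral_le_lintegral_enorm _
    _ ≤ _ := lintegral_mono_set
      (Set.uIoc_subset_uIcc.trans (Set.uIcc_subset_Icc hs ht))

/-- The one-dimensional Sobolev embedding `H¹(0,1) ⊂ L^∞`. -/
lemma enorm_sq_le_lintegral_sq_add_deriv {h : ℝ → ℂ} (hh : ContDiff ℝ 1 h) {t : ℝ}
    (ht : t ∈ Set.Icc (0 : ℝ) 1) :
    ‖h t‖ₑ ^ 2 ≤ 2 * ((∫⁻ x in Set.Icc (0 : ℝ) 1, ‖h x‖ₑ ^ 2) +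
      ∫⁻ x in Set.Icc (0 : ℝ) 1, ‖deriv h x‖ₑ ^ 2) := by
  set J := ∫⁻ x in Set.Icc (0 : ℝ) 1, ‖deriv h x‖ₑ ^ 2
  have hJ : (∫⁻ x in Set.Icc (0 : ℝ) 1, ‖deriv h x‖ₑ) ^ 2 ≤ J := by
    have := lintegral_mul_sq_le (μ := volume.restrict (Set.Icc (0 : ℝ) 1))
      (f := fun x => ‖deriv h x‖ₑ) (g := fun _ => 1)
      (hh.continuous_deriv le_rfl).enorm.aemeasurable aemeasurable_const
    simpa using this
  have hpt : ∀ s ∈ Set.Icc (0 : ℝ) 1, ‖h t‖ₑ ^ 2 ≤ 2 * (‖h s‖ₑ ^ 2 + J) := fun s hs => by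
    calc ‖h t‖ₑ ^ 2 = ‖h s + (h t - h s)‖ₑ ^ 2 := by congr 2; ring
      _ ≤ (‖h s‖ₑ + ∫⁻ x in Set.Icc (0 : ℝ) 1, ‖deriv h x‖ₑ) ^ 2 := by
        gcongr
        exact (enorm_add_le _ _).trans (add_le_add le_rfl (enorm_sub_le_lintegral_deriv hh hs ht))
      _ ≤ 2 * (‖h s‖ₑ ^ 2 + (∫⁻ x in Set.Icc (0 : ℝ) 1, ‖deriv h x‖ₑ) ^ 2) :=
        ennreal_add_sq_le _ _
      _ ≤ _ := by gcongr
  calc ‖h t‖ₑ ^ 2 = ∫⁻ _ in Set.Icc (0 : ℝ) 1, ‖h t‖ₑ ^ 2 := by simp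
    _ ≤ ∫⁻ s in Set.Icc (0 : ℝ) 1, 2 * (‖h s‖ₑ ^ 2 + J) :=
      setLIntegral_mono' measurableSet_Icc hpt
    _ = _ := by
      rw [lintegral_const_mul' _ _ (by norm_num), lintegral_add_right _ measurable_const]
      simp

/-- A series of `C¹` functions whose derivatives are summable in `L¹(0,1)` may be differentiated
termwise almost everywhere. -/
lemma ae_hasDerivAt_tsum {ι : Type*} [Countable ι] {φ : ι → ℝ → ℂ}
    (hφ : ∀ j, ContDiff ℝ 1 (φ j)) (h0 : Summable fun j => φ j 0)
    (hL : ∑' j, ∫⁻ x in Set.Icc (0 : ℝ) 1, ‖deriv (φ j) x‖ₑ ≠ ∞) :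
    ∀ᵐ t, t ∈ Set.Ioo (0 : ℝ) 1 →
      HasDerivAt (fun z => ∑' j, φ j z) (∑' j, deriv (φ j) t) t := by
  have hmeas (j : ι) : Continuous (deriv (φ j)) := (hφ j).continuous_deriv le_rfl
  have hint : IntervalIntegrable (fun t => ∑' j, deriv (φ j) t) volume 0 1 := by
    rw [intervalIntegrable_iff_integrableOn_Icc_of_le zero_le_one]
    refine ⟨(Measurable.tsum fun j => (hmeas j).measurable).aestronglyMeasurable, ?_⟩
    refine lt_of_le_of_lt (lintegral_mono fun t => enorm_tsum_le_tsum_enorm) ?_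
    rw [lintegral_tsum fun j => (hmeas j).enorm.aemeasurable]
    exact hL.lt_top
  have hF : ∀ t ∈ Set.Icc (0 : ℝ) 1,
      ∑' j, φ j t = (∑' j, φ j 0) + ∫ x in (0 : ℝ)..t, ∑' j, deriv (φ j) x := fun t ht => by
    have hLt : ∑' j, ∫⁻ x in Set.Ioc (0 : ℝ) t, ‖deriv (φ j) x‖ₑ ≠ ∞ :=
      ne_top_of_le_ne_top hL (ENNReal.tsum_le_tsum fun j =>
        lintegral_mono_set (Set.Ioc_subset_Icc_self.trans (Set.Icc_subset_Icc_right ht.2)))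
    have hsum : Summable fun j => ∫ x in Set.Ioc (0 : ℝ) t, deriv (φ j) x :=
      .of_enorm (ne_top_of_le_ne_top hLt
        (ENNReal.tsum_le_tsum fun j => enorm_integral_le_lintegral_enorm _))
    rw [intervalIntegral.integral_of_le ht.1,
      integral_tsum (fun j => (hmeas j).aestronglyMeasurable) hLt, ← h0.tsum_add hsum]
    refine tsum_congr fun j => ?_
    rw [← intervalIntegral.integral_of_le ht.1, intervalIntegral.integral_deriv_eq_sub
      (fun x _ => ((hφ j).differentiable (by norm_num)).differentiableAt)
      ((hmeas j).intervalIntegrable _ _)]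
    ring
  filter_upwards [hint.ae_hasDerivAt_integral] with t ht htI
  have h1 := (ht (by rw [Set.uIcc_of_le zero_le_one]; exact Set.Ioo_subset_Icc_self htI) 0
    (by simp)).const_add (∑' j, φ j 0)
  refine h1.congr_of_eventuallyEq ?_
  filter_upwards [isOpen_Ioo.mem_nhds htI] with z hz
  exact hF z (Set.Ioo_subset_Icc_self hz)

lemma contDiff_one_iteratedDeriv {h : ℝ → ℂ} {m r : ℕ} (hh : ContDiff ℝ m h) (hr : r < m) :
    ContDiff ℝ 1 (iteratedDeriv r h) := by
  rw [iteratedDeriv_eq_iterate]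
  exact ContDiff.iterate_deriv' 1 r (hh.of_le (by norm_cast; omega))

/-- Termwise differentiation of a series of `C^m` functions: the derivatives of order `< m` are
summable in `L^∞(0,1)`, those of order `m` only in `L¹(0,1)`. -/
lemma ae_enorm_iteratedDeriv_tsum_le {ι : Type*} [Countable ι] {φ : ι → ℝ → ℂ} {m : ℕ}
    (hφ : ∀ j, ContDiff ℝ m (φ j))
    (hsup : ∀ p < m, ∃ u : ι → ℝ≥0∞, ∑' j, u j ≠ ∞ ∧
      ∀ j, ∀ t ∈ Set.Icc (0 : ℝ) 1, ‖iteratedDeriv p (φ j) t‖ₑ ≤ u j)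
    (hL : ∀ p ≤ m, ∑' j, ∫⁻ x in Set.Icc (0 : ℝ) 1, ‖iteratedDeriv p (φ j) x‖ₑ ≠ ∞)
    {p : ℕ} (hp : p ≤ m) :
    ∀ᵐ t ∂(volume.restrict (Set.Icc (0 : ℝ) 1)),
      ‖iteratedDeriv p (fun z => ∑' j, φ j z) t‖ₑ ≤ ∑' j, ‖iteratedDeriv p (φ j) t‖ₑ := by
  have hC1 : ∀ q < m, ∀ j, ContDiff ℝ 1 (iteratedDeriv q (φ j)) := fun q hq j =>
    contDiff_one_iteratedDeriv (hφ j) hq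
  have hsummable : ∀ q < m, ∀ t ∈ Set.Icc (0 : ℝ) 1,
      Summable fun j => iteratedDeriv q (φ j) t := fun q hq t ht => by
    obtain ⟨u, hu, hle⟩ := hsup q hq
    exact .of_enorm (ne_top_of_le_ne_top hu (ENNReal.tsum_le_tsum fun j => hle j t ht))
  have heq : ∀ q < m, ∀ t ∈ Set.Ioo (0 : ℝ) 1,
      iteratedDeriv q (fun z => ∑' j, φ j z) t = ∑' j, iteratedDeriv q (φ j) t := by
    intro q
    induction q with
    | zero => intro _ t _; simp
    | succ q ih =>
      intro hq t ht
      obtain ⟨u, hu, hle⟩ := hsup (q + 1) hq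
      have hd := hasDerivAt_tsum_of_isPreconnected (ENNReal.summable_toReal hu) isOpen_Ioo
        isPreconnected_Ioo (g := fun j => iteratedDeriv q (φ j))
        (g' := fun j => iteratedDeriv (q + 1) (φ j))
        (fun j y _ => by
          rw [iteratedDeriv_succ]
          exact ((hC1 q (by omega) j).differentiable (by norm_num) y).hasDerivAt)
        (fun j y hy => by
          rw [← toReal_enorm]
          exact ENNReal.toReal_mono (ENNReal.ne_top_of_tsum_ne_top hu j)
            (hle j y (Set.Ioo_subset_Icc_self hy)))
        ht (hsummable q (by omega) t (Set.Ioo_subset_Icc_self ht)) ht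
      rw [iteratedDeriv_succ, ← hd.deriv]
      refine Filter.EventuallyEq.deriv_eq ?_
      filter_upwards [isOpen_Ioo.mem_nhds ht] with z hz using ih (by omega) z hz
  rcases p with _ | p
  · filter_upwards with t
    simpa using enorm_tsum_le_tsum_enorm
  rw [restrict_Ioo_eq_restrict_Icc.symm, ae_restrict_iff' measurableSet_Ioo]
  filter_upwards [ae_hasDerivAt_tsum (hC1 p (by omega))
    (hsummable p (by omega) 0 (by simp))
    (by simpa only [← iteratedDeriv_succ] using hL (p + 1) hp)] with t ht htI
  have h1 : iteratedDeriv (p + 1) (fun z => ∑' j, φ j z) t =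
      ∑' j, iteratedDeriv (p + 1) (φ j) t := by
    simp only [iteratedDeriv_succ]
    rw [← (ht htI).deriv]
    refine Filter.EventuallyEq.deriv_eq ?_
    filter_upwards [isOpen_Ioo.mem_nhds htI] with z hz using heq p (by omega) z hz
  rw [h1]
  exact enorm_tsum_le_tsum_enorm

/-- The Leibniz rule as an inequality. -/
lemma enorm_iteratedDeriv_mul_le {f g : ℝ → ℂ} {m p : ℕ} (hf : ContDiff ℝ m f)
    (hg : ContDiff ℝ m g) (hp : p ≤ m) (t : ℝ) :
    ‖iteratedDeriv p (fun z => f z * g z) t‖ₑ ≤ ∑ r ∈ Finset.range (p + 1),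
      (p.choose r : ℝ≥0∞) * (‖iteratedDeriv r f t‖ₑ * ‖iteratedDeriv (p - r) g t‖ₑ) := by
  have h := norm_iteratedFDeriv_mul_le hf hg t (n := p) (by exact_mod_cast hp)
  simp only [norm_iteratedFDeriv_eq_norm_iteratedDeriv] at h
  rw [← ofReal_norm]
  refine (ENNReal.ofReal_le_ofReal h).trans_eq ?_
  rw [ENNReal.ofReal_sum_of_nonneg fun i _ => by positivity]
  refine Finset.sum_congr rfl fun r _ => ?_
  rw [ENNReal.ofReal_mul (by positivity), ENNReal.ofReal_mul (by positivity),
    ENNReal.ofReal_natCast, ofReal_norm, ofReal_norm, mul_assoc]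

/-- `‖D^r h‖²` in `L²(0,1)`. -/
noncomputable def derivEnergy (r : ℕ) (h : ℝ → ℂ) : ℝ≥0∞ :=
  ∫⁻ t in Set.Icc (0 : ℝ) 1, ‖iteratedDeriv r h t‖ₑ ^ 2

lemma enorm_iteratedDeriv_sq_le {h : ℝ → ℂ} {m r : ℕ} (hh : ContDiff ℝ m h) (hr : r < m) {t : ℝ}
    (ht : t ∈ Set.Icc (0 : ℝ) 1) :
    ‖iteratedDeriv r h t‖ₑ ^ 2 ≤ 2 * (derivEnergy r h + derivEnergy (r + 1) h) := by
  simpa only [derivEnergy, iteratedDeriv_succ] using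
    enorm_sq_le_lintegral_sq_add_deriv (contDiff_one_iteratedDeriv hh hr) ht

lemma tsum_comp_sub_left (F : ℤ → ℝ≥0∞) (k : ℤ) : ∑' j, F (k - j) = ∑' j, F j :=
  (Equiv.subLeft k).tsum_eq F

lemma ae_enorm_iteratedDeriv_conv_le {a b : ℤ → ℝ → ℂ} {m : ℕ}
    (ha : ∀ k, ContDiff ℝ m (a k)) (hb : ∀ k, ContDiff ℝ m (b k))
    (hEa : ∀ r ≤ m, ∑' j, derivEnergy r (a j) ≠ ∞)
    (hEb : ∀ r ≤ m, ∑' j, derivEnergy r (b j) ≠ ∞) {p : ℕ} (hp : p ≤ m) (k : ℤ) :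
    ∀ᵐ t ∂(volume.restrict (Set.Icc (0 : ℝ) 1)),
      ‖iteratedDeriv p (conv a b k) t‖ₑ ≤ ∑ r ∈ Finset.range (p + 1), (p.choose r : ℝ≥0∞) *
        ∑' j, ‖iteratedDeriv r (a j) t‖ₑ * ‖iteratedDeriv (p - r) (b (k - j)) t‖ₑ := by
  have hEb' : ∀ r ≤ m, ∑' j, derivEnergy r (b (k - j)) ≠ ∞ := fun r hr => by
    rw [tsum_comp_sub_left (fun j => derivEnergy r (b j))]
    exact hEb r hr
  have key := ae_enorm_iteratedDeriv_tsum_le (φ := fun j z => a j z * b (k - j) z) (m := m)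
    (fun j => (ha j).mul (hb (k - j))) ?_ ?_ hp
  · filter_upwards [key] with t ht
    refine ht.trans ?_
    calc _ ≤ ∑' j, ∑ r ∈ Finset.range (p + 1), (p.choose r : ℝ≥0∞) *
          (‖iteratedDeriv r (a j) t‖ₑ * ‖iteratedDeriv (p - r) (b (k - j)) t‖ₑ) :=
          ENNReal.tsum_le_tsum fun j => enorm_iteratedDeriv_mul_le (ha j) (hb (k - j)) hp t
      _ = _ := by
        rw [Summable.tsum_finsetSum fun _ _ => ENNReal.summable]
        simp only [ENNReal.tsum_mul_left]
  · intro p hp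
    refine ⟨fun j => ∑ r ∈ Finset.range (p + 1), (p.choose r : ℝ≥0∞) *
      (2 * (derivEnergy r (a j) + derivEnergy (r + 1) (a j)) +
        2 * (derivEnergy (p - r) (b (k - j)) + derivEnergy (p - r + 1) (b (k - j)))), ?_, ?_⟩
    · rw [Summable.tsum_finsetSum fun _ _ => ENNReal.summable]
      refine ENNReal.sum_ne_top.2 fun r hr => ?_
      have hr : r ≤ p := by simpa [Nat.lt_succ_iff] using hr
      simp only [ENNReal.tsum_mul_left, ENNReal.tsum_add]
      have h1 := hEa r (by omega)
      have h2 := hEa (r + 1) (by omega)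
      have h3 := hEb' (p - r) (by omega)
      have h4 := hEb' (p - r + 1) (by omega)
      finiteness
    · intro j t ht
      refine (enorm_iteratedDeriv_mul_le (ha j) (hb (k - j)) hp.le t).trans ?_
      refine Finset.sum_le_sum fun r hr => ?_
      have hr : r ≤ p := by simpa [Nat.lt_succ_iff] using hr
      gcongr
      exact (ennreal_mul_le_sq_add_sq _ _).trans (add_le_add
        (enorm_iteratedDeriv_sq_le (ha j) (by omega) ht)
        (enorm_iteratedDeriv_sq_le (hb (k - j)) (by omega) ht))
  · intro p hp
    have hle (j : ℤ) : ∫⁻ x in Set.Icc (0 : ℝ) 1,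
        ‖iteratedDeriv p (fun z => a j z * b (k - j) z) x‖ₑ ≤
        ∑ r ∈ Finset.range (p + 1), (p.choose r : ℝ≥0∞) *
          (derivEnergy r (a j) + derivEnergy (p - r) (b (k - j))) := by
      calc _ ≤ ∫⁻ x in Set.Icc (0 : ℝ) 1, ∑ r ∈ Finset.range (p + 1), (p.choose r : ℝ≥0∞) *
            (‖iteratedDeriv r (a j) x‖ₑ ^ 2 + ‖iteratedDeriv (p - r) (b (k - j)) x‖ₑ ^ 2) := by
            refine lintegral_mono fun x => ?_
            refine (enorm_iteratedDeriv_mul_le (ha j) (hb (k - j)) hp x).trans ?_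
            gcongr
            exact ennreal_mul_le_sq_add_sq _ _
        _ = _ := by
          have hma : ∀ r ∈ Finset.range (p + 1), Measurable fun x =>
              ‖iteratedDeriv r (a j) x‖ₑ ^ 2 := fun r hr =>
            (((ha j).continuous_iteratedDeriv r (by
              norm_cast; have := Finset.mem_range.1 hr; omega)).enorm.measurable.pow_const 2)
          have hmb : ∀ r, Measurable fun x =>
              ‖iteratedDeriv (p - r) (b (k - j)) x‖ₑ ^ 2 := fun r =>
            (((hb (k - j)).continuous_iteratedDeriv (p - r) (by
              norm_cast; omega)).enorm.measurable.pow_const 2)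
          rw [lintegral_finsetSum']
          swap
          · exact fun r hr => (((hma r hr).add (hmb r)).const_mul _).aemeasurable
          refine Finset.sum_congr rfl fun r hr => ?_
          rw [lintegral_const_mul' _ _ (by finiteness), lintegral_add_left (hma r hr)]
          rfl
    refine ne_top_of_le_ne_top ?_ (ENNReal.tsum_le_tsum hle)
    rw [Summable.tsum_finsetSum fun _ _ => ENNReal.summable]
    refine ENNReal.sum_ne_top.2 fun r hr => ?_
    have hr : r ≤ p := by simpa [Nat.lt_succ_iff] using hr
    simp only [ENNReal.tsum_mul_left, ENNReal.tsum_add]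
    have h1 := hEa r (by omega)
    have h3 := hEb' (p - r) (by omega)
    finiteness

/-- The Japanese bracket `1 + |j|`. -/
noncomputable def bracket (j : ℤ) : ℝ≥0∞ := 1 + (j.natAbs : ℝ≥0∞)

lemma tsum_bracket_inv_sq_ne_top : ∑' j, (bracket j)⁻¹ ^ 2 ≠ ∞ := by
  have hnat : Summable fun n : ℕ => ((n + 1 : ℝ) ^ 2)⁻¹ := by
    simpa using (summable_nat_add_iff 1).2 (Real.summable_nat_pow_inv.2 one_lt_two)
  have hint : Summable fun j : ℤ => ((j.natAbs + 1 : ℝ) ^ 2)⁻¹ :=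
    .of_nat_of_neg (by simpa using hnat) (by simpa using hnat)
  have heq (j : ℤ) : (bracket j)⁻¹ ^ 2 = ENNReal.ofReal ((j.natAbs + 1 : ℝ) ^ 2)⁻¹ := by
    rw [ENNReal.ofReal_inv_of_pos (by positivity), ENNReal.ofReal_pow (by positivity),
      ENNReal.ofReal_add (by positivity) zero_le_one, ENNReal.ofReal_natCast, ENNReal.ofReal_one,
      ENNReal.inv_pow, bracket, add_comm]
  simp only [heq]
  exact hint.tsum_ofReal_ne_top

/-- Weighted Young-type inequality for convolutions. -/
lemma tsum_lintegral_convolution_sq_le {f g : ℤ → ℝ → ℝ≥0∞} (hf : ∀ j, Measurable (f j))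
    (hg : ∀ j, Measurable (g j)) (μ : Measure ℝ) :
    ∑' k : ℤ, ∫⁻ t, (∑' j, f j t * g (k - j) t) ^ 2 ∂μ ≤
      (∑' j, (bracket j)⁻¹ ^ 2) * ∑' j, ∑' l, bracket j ^ 2 * ∫⁻ t, f j t ^ 2 * g l t ^ 2 ∂μ := by
  have hpt (k : ℤ) (t : ℝ) : (∑' j, f j t * g (k - j) t) ^ 2 ≤
      (∑' j, (bracket j)⁻¹ ^ 2) * ∑' j, bracket j ^ 2 * (f j t ^ 2 * g (k - j) t ^ 2) := by
    calc _ = (∑' j, (bracket j)⁻¹ * (bracket j * (f j t * g (k - j) t))) ^ 2 := by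
          congr 1
          refine tsum_congr fun j => ?_
          rw [← mul_assoc, ENNReal.inv_mul_cancel (by simp [bracket]) (by simp [bracket]), one_mul]
      _ ≤ _ := tsum_mul_sq_le _ _
      _ = _ := by simp only [mul_pow]
  calc _ ≤ ∑' k : ℤ, ∫⁻ t, (∑' j, (bracket j)⁻¹ ^ 2) *
        ∑' j, bracket j ^ 2 * (f j t ^ 2 * g (k - j) t ^ 2) ∂μ :=
        ENNReal.tsum_le_tsum fun k => lintegral_mono fun t => hpt k t
    _ = (∑' j, (bracket j)⁻¹ ^ 2) *
        ∑' k : ℤ, ∑' j, bracket j ^ 2 * ∫⁻ t, f j t ^ 2 * g (k - j) t ^ 2 ∂μ := by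
      rw [← ENNReal.tsum_mul_left]
      refine tsum_congr fun k => ?_
      rw [lintegral_const_mul' _ _ tsum_bracket_inv_sq_ne_top, lintegral_tsum fun j => by fun_prop]
      congr 1
      refine tsum_congr fun j => lintegral_const_mul' _ _ (by simp [bracket])
    _ = _ := by
      congr 1
      rw [ENNReal.tsum_comm]
      refine tsum_congr fun j => ?_
      exact (Equiv.subRight j).tsum_eq
        (fun l => bracket j ^ 2 * ∫⁻ t, f j t ^ 2 * g l t ^ 2 ∂μ)

/-- The Fourier weight `|j|^s e^{σ|j|}`. -/
noncomputable def fourierWeight (σ : ℝ) (s : ℕ) (j : ℤ) : ℝ≥0∞ :=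
  (j.natAbs : ℝ≥0∞) ^ s * ENNReal.ofReal (Real.exp (σ * |(j : ℝ)|))

lemma fourierWeight_ne_top (σ : ℝ) (s : ℕ) (j : ℤ) : fourierWeight σ s j ≠ ∞ := by
  unfold fourierWeight
  finiteness

lemma fourierWeight_sq (σ : ℝ) (q : ℕ) (k : ℤ) :
    fourierWeight σ q k ^ 2 =
      ENNReal.ofReal ((k : ℝ) ^ (2 * q) * Real.exp (2 * σ * |(k : ℝ)|)) := by
  have hk : (k.natAbs : ℝ≥0∞) = ENNReal.ofReal |(k : ℝ)| := by
    rw [← Int.cast_abs, Int.abs_eq_natAbs, Int.cast_natCast, ENNReal.ofReal_natCast]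
  rw [fourierWeight, hk, ← ENNReal.ofReal_pow (abs_nonneg _), ← ENNReal.ofReal_mul (by positivity),
    ← ENNReal.ofReal_pow (by positivity)]
  congr 1
  rw [mul_pow, ← pow_mul, mul_comm q 2, pow_mul, sq_abs, ← pow_mul, ← Real.exp_nat_mul]
  congr 2
  push_cast
  ring

lemma bracket_sq_mul_fourierWeight_sq_le (σ : ℝ) (s : ℕ) (j : ℤ) :
    bracket j ^ 2 * fourierWeight σ s j ^ 2 ≤
      2 * (fourierWeight σ s j ^ 2 + fourierWeight σ (s + 1) j ^ 2) := by
  calc _ = (fourierWeight σ s j + fourierWeight σ (s + 1) j) ^ 2 := by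
        rw [bracket, fourierWeight, fourierWeight]; ring
    _ ≤ _ := ennreal_add_sq_le _ _

lemma fourierWeight_le {σ : ℝ} (hσ : 0 < σ) (q : ℕ) (k j : ℤ) :
    fourierWeight σ q k ≤ 2 ^ q * (fourierWeight σ q j * fourierWeight σ 0 (k - j) +
      fourierWeight σ 0 j * fourierWeight σ q (k - j)) := by
  have hexp : ENNReal.ofReal (Real.exp (σ * |(k : ℝ)|)) ≤
      ENNReal.ofReal (Real.exp (σ * |(j : ℝ)|)) *
        ENNReal.ofReal (Real.exp (σ * |((k - j : ℤ) : ℝ)|)) := by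
    rw [← ENNReal.ofReal_mul (by positivity), ← Real.exp_add, ← mul_add]
    gcongr
    have := abs_add_le (j : ℝ) ((k - j : ℤ) : ℝ)
    simpa using this
  have hnat : (k.natAbs : ℝ≥0∞) ^ q ≤
      2 ^ q * ((j.natAbs : ℝ≥0∞) ^ q + ((k - j).natAbs : ℝ≥0∞) ^ q) := by
    have h1 : k.natAbs ^ q ≤ 2 ^ q * (j.natAbs ^ q + (k - j).natAbs ^ q) := by
      calc k.natAbs ^ q ≤ (2 * max j.natAbs (k - j).natAbs) ^ q :=
            Nat.pow_le_pow_left (by omega) q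
        _ ≤ _ := by
          rw [mul_pow]
          gcongr
          rcases max_cases j.natAbs (k - j).natAbs with h | h <;> rw [h.1] <;> omega
    exact_mod_cast h1
  calc fourierWeight σ q k ≤ (2 ^ q * ((j.natAbs : ℝ≥0∞) ^ q + ((k - j).natAbs : ℝ≥0∞) ^ q)) *
        (ENNReal.ofReal (Real.exp (σ * |(j : ℝ)|)) *
        ENNReal.ofReal (Real.exp (σ * |((k - j : ℤ) : ℝ)|))) := mul_le_mul' hnat hexp
    _ = _ := by simp only [fourierWeight, pow_zero, one_mul]; ring

lemma one_le_fourierWeight_zero {σ : ℝ} (hσ : 0 < σ) (j : ℤ) : 1 ≤ fourierWeight σ 0 j := by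
  rw [fourierWeight, pow_zero, one_mul, ← ENNReal.ofReal_one]
  exact ENNReal.ofReal_le_ofReal (Real.one_le_exp (by positivity))

/-- The summand of the squared `Y_σ^m` norm with `r` derivatives in `ψ` and `s` in `x`. -/
noncomputable def levelSq (σ : ℝ) (r s : ℕ) (a : ℤ → ℝ → ℂ) : ℝ≥0∞ :=
  ∑' j, fourierWeight σ s j ^ 2 * derivEnergy r (a j)

lemma YcSq_eq_sum_levelSq (σ : ℝ) (m : ℕ) (a : ℤ → ℝ → ℂ) :
    YcSq σ m a = ∑ p ∈ Finset.range (m + 1), ∑ q ∈ Finset.range (m + 1 - p), levelSq σ p q a := by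
  simp only [levelSq, fourierWeight_sq]
  rfl

lemma levelSq_le_YcSq (σ : ℝ) {m r s : ℕ} (h : r + s ≤ m) (a : ℤ → ℝ → ℂ) :
    levelSq σ r s a ≤ YcSq σ m a := by
  rw [YcSq_eq_sum_levelSq]
  calc _ ≤ ∑ q ∈ Finset.range (m + 1 - r), levelSq σ r q a :=
        Finset.single_le_sum (f := fun q => levelSq σ r q a) (fun _ _ => zero_le)
          (Finset.mem_range.2 (by omega))
    _ ≤ _ := Finset.single_le_sum
        (f := fun p => ∑ q ∈ Finset.range (m + 1 - p), levelSq σ p q a) (fun _ _ => zero_le)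
          (Finset.mem_range.2 (by omega))

lemma tsum_derivEnergy_ne_top {σ : ℝ} (hσ : 0 < σ) {m r : ℕ} (hr : r ≤ m) {a : ℤ → ℝ → ℂ}
    (ha : YcSq σ m a < ⊤) : ∑' j, derivEnergy r (a j) ≠ ∞ := by
  refine ne_top_of_le_ne_top ha.ne
    (le_trans ?_ (levelSq_le_YcSq σ (r := r) (s := 0) (by omega) a))
  refine ENNReal.tsum_le_tsum fun j => le_mul_of_one_le_left zero_le ?_
  exact one_le_pow₀ (one_le_fourierWeight_zero hσ j)

/-- The modulus of the weighted coefficients `|j|^s e^{σ|j|} D^r â_j`. -/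
noncomputable def weightedCoeff (σ : ℝ) (r s : ℕ) (a : ℤ → ℝ → ℂ) (j : ℤ) (t : ℝ) : ℝ≥0∞ :=
  fourierWeight σ s j * ‖iteratedDeriv r (a j) t‖ₑ

section weightedCoeff

variable {σ : ℝ} {m r s : ℕ} {a : ℤ → ℝ → ℂ}

lemma measurable_weightedCoeff (ha : ∀ k, ContDiff ℝ m (a k)) (hr : r ≤ m) (j : ℤ) :
    Measurable (weightedCoeff σ r s a j) :=
  ((ha j).continuous_iteratedDeriv r (by exact_mod_cast hr)).enorm.measurable.const_mul _

lemma lintegral_weightedCoeff_sq (j : ℤ) :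
    ∫⁻ t in Set.Icc (0 : ℝ) 1, weightedCoeff σ r s a j t ^ 2 =
      fourierWeight σ s j ^ 2 * derivEnergy r (a j) := by
  simp only [weightedCoeff, mul_pow]
  exact lintegral_const_mul' _ _ (ENNReal.pow_ne_top (fourierWeight_ne_top σ s j))

lemma weightedCoeff_sq_le (ha : ∀ k, ContDiff ℝ m (a k)) (hr : r < m) (j : ℤ) {t : ℝ}
    (ht : t ∈ Set.Icc (0 : ℝ) 1) :
    weightedCoeff σ r s a j t ^ 2 ≤
      2 * (fourierWeight σ s j ^ 2 * (derivEnergy r (a j) + derivEnergy (r + 1) (a j))) := by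
  rw [weightedCoeff, mul_pow, mul_left_comm]
  gcongr
  exact enorm_iteratedDeriv_sq_le (ha j) hr ht

lemma tsum_fourierWeight_sq_mul_derivEnergy_add_le (h : r + 1 + s ≤ m) :
    ∑' j, fourierWeight σ s j ^ 2 * (derivEnergy r (a j) + derivEnergy (r + 1) (a j)) ≤
      2 * YcSq σ m a := by
  simp only [mul_add, ENNReal.tsum_add, two_mul]
  exact add_le_add (levelSq_le_YcSq σ (by omega) a) (levelSq_le_YcSq σ h a)

lemma tsum_bracket_sq_mul_le (E : ℤ → ℝ≥0∞) :
    ∑' j, bracket j ^ 2 * (fourierWeight σ s j ^ 2 * E j) ≤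
      2 * (∑' j, fourierWeight σ s j ^ 2 * E j + ∑' j, fourierWeight σ (s + 1) j ^ 2 * E j) := by
  rw [← ENNReal.tsum_add, ← ENNReal.tsum_mul_left]
  refine ENNReal.tsum_le_tsum fun j => ?_
  rw [← mul_assoc, ← add_mul, ← mul_assoc]
  exact mul_le_mul' (bracket_sq_mul_fourierWeight_sq_le σ s j) le_rfl

end weightedCoeff

section bilinear

variable {σ : ℝ} {m r s u v : ℕ} {a b : ℤ → ℝ → ℂ}

/-- `ℓ¹L² ∗ ℓ²L^∞ ⊂ ℓ²L²`. -/
lemma tsum_tsum_bracket_le_of_right_sup (ha : ∀ k, ContDiff ℝ m (a k))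
    (hb : ∀ k, ContDiff ℝ m (b k)) (h : r + s + 1 ≤ m) (huv : u + v + 1 ≤ m) :
    ∑' j, ∑' l, bracket j ^ 2 * ∫⁻ t in Set.Icc (0 : ℝ) 1,
      weightedCoeff σ r s a j t ^ 2 * weightedCoeff σ u v b l t ^ 2 ≤
      16 * (YcSq σ m a * YcSq σ m b) := by
  have hint (j l : ℤ) : ∫⁻ t in Set.Icc (0 : ℝ) 1,
      weightedCoeff σ r s a j t ^ 2 * weightedCoeff σ u v b l t ^ 2 ≤
      (fourierWeight σ s j ^ 2 * derivEnergy r (a j)) * (2 * (fourierWeight σ v l ^ 2 *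
        (derivEnergy u (b l) + derivEnergy (u + 1) (b l)))) := by
    rw [← lintegral_weightedCoeff_sq]
    refine le_trans (setLIntegral_mono' measurableSet_Icc fun t ht =>
      mul_le_mul' le_rfl (weightedCoeff_sq_le hb (by omega) l ht)) ?_
    rw [lintegral_mul_const _ ((measurable_weightedCoeff ha (by omega) j).pow_const 2)]
  calc _ ≤ ∑' j, ∑' l, (bracket j ^ 2 * (fourierWeight σ s j ^ 2 * derivEnergy r (a j))) *
        (2 * (fourierWeight σ v l ^ 2 * (derivEnergy u (b l) + derivEnergy (u + 1) (b l)))) := by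
        refine ENNReal.tsum_le_tsum fun j => ENNReal.tsum_le_tsum fun l => ?_
        rw [mul_assoc (bracket j ^ 2)]
        gcongr
        exact hint j l
    _ = (∑' j, bracket j ^ 2 * (fourierWeight σ s j ^ 2 * derivEnergy r (a j))) *
        (2 * ∑' l, fourierWeight σ v l ^ 2 *
          (derivEnergy u (b l) + derivEnergy (u + 1) (b l))) := by
      simp only [ENNReal.tsum_mul_left, ENNReal.tsum_mul_right]
    _ ≤ (2 * (YcSq σ m a + YcSq σ m a)) * (2 * (2 * YcSq σ m b)) := by
      gcongr
      · refine (tsum_bracket_sq_mul_le _).trans ?_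
        gcongr
        · exact levelSq_le_YcSq σ (by omega) a
        · exact levelSq_le_YcSq σ (by omega) a
      · exact tsum_fourierWeight_sq_mul_derivEnergy_add_le (by omega)
    _ = _ := by ring

/-- `ℓ¹L^∞ ∗ ℓ²L² ⊂ ℓ²L²`. -/
lemma tsum_tsum_bracket_le_of_left_sup (ha : ∀ k, ContDiff ℝ m (a k))
    (hb : ∀ k, ContDiff ℝ m (b k)) (h : r + s + 2 ≤ m) (huv : u + v ≤ m) :
    ∑' j, ∑' l, bracket j ^ 2 * ∫⁻ t in Set.Icc (0 : ℝ) 1,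
      weightedCoeff σ r s a j t ^ 2 * weightedCoeff σ u v b l t ^ 2 ≤
      16 * (YcSq σ m a * YcSq σ m b) := by
  have hint (j l : ℤ) : ∫⁻ t in Set.Icc (0 : ℝ) 1,
      weightedCoeff σ r s a j t ^ 2 * weightedCoeff σ u v b l t ^ 2 ≤
      2 * (fourierWeight σ s j ^ 2 * (derivEnergy r (a j) + derivEnergy (r + 1) (a j))) *
        (fourierWeight σ v l ^ 2 * derivEnergy u (b l)) := by
    rw [← lintegral_weightedCoeff_sq]
    refine le_trans (setLIntegral_mono' measurableSet_Icc fun t ht =>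
      mul_le_mul' (weightedCoeff_sq_le ha (by omega) j ht) le_rfl) ?_
    rw [lintegral_const_mul _ ((measurable_weightedCoeff hb (by omega) l).pow_const 2)]
  calc _ ≤ ∑' j, ∑' l, (2 * (bracket j ^ 2 * (fourierWeight σ s j ^ 2 *
          (derivEnergy r (a j) + derivEnergy (r + 1) (a j))))) *
        (fourierWeight σ v l ^ 2 * derivEnergy u (b l)) := by
        refine ENNReal.tsum_le_tsum fun j => ENNReal.tsum_le_tsum fun l => ?_
        rw [mul_left_comm 2, mul_assoc (bracket j ^ 2)]
        gcongr
        exact hint j l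
    _ = (2 * ∑' j, bracket j ^ 2 * (fourierWeight σ s j ^ 2 *
          (derivEnergy r (a j) + derivEnergy (r + 1) (a j)))) * levelSq σ u v b := by
      simp only [ENNReal.tsum_mul_left, ENNReal.tsum_mul_right, levelSq]
    _ ≤ (2 * (2 * (2 * YcSq σ m a + 2 * YcSq σ m a))) * YcSq σ m b := by
      gcongr
      · refine (tsum_bracket_sq_mul_le _).trans ?_
        gcongr
        · exact tsum_fourierWeight_sq_mul_derivEnergy_add_le (by omega)
        · exact tsum_fourierWeight_sq_mul_derivEnergy_add_le (by omega)
      · exact levelSq_le_YcSq σ huv b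
    _ = _ := by ring

/-- The product estimate for weighted coefficients whose orders add up to at most `m`. -/
lemma tsum_lintegral_weightedCoeff_convolution_sq_le (hm : 1 < m) (ha : ∀ k, ContDiff ℝ m (a k))
    (hb : ∀ k, ContDiff ℝ m (b k)) (h : r + s + (u + v) ≤ m) :
    ∑' k : ℤ, ∫⁻ t in Set.Icc (0 : ℝ) 1,
      (∑' j, weightedCoeff σ r s a j t * weightedCoeff σ u v b (k - j) t) ^ 2 ≤
      (∑' j, (bracket j)⁻¹ ^ 2) * (16 * (YcSq σ m a * YcSq σ m b)) := by
  have hfa := measurable_weightedCoeff (σ := σ) (s := s) ha (r := r) (by omega)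
  have hfb := measurable_weightedCoeff (σ := σ) (s := v) hb (r := u) (by omega)
  by_cases h1 : u + v + 2 ≤ m
  · calc _ = ∑' k : ℤ, ∫⁻ t in Set.Icc (0 : ℝ) 1,
          (∑' j, weightedCoeff σ u v b j t * weightedCoeff σ r s a (k - j) t) ^ 2 := by
          refine tsum_congr fun k => lintegral_congr fun t => ?_
          rw [← tsum_comp_sub_left _ k]
          congr 1
          refine tsum_congr fun j => ?_
          rw [sub_sub_cancel, mul_comm]
      _ ≤ _ := tsum_lintegral_convolution_sq_le hfb hfa _
      _ ≤ _ := by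
        rw [mul_comm (YcSq σ m a)]
        gcongr
        exact tsum_tsum_bracket_le_of_left_sup hb ha h1 (by omega)
  · refine (tsum_lintegral_convolution_sq_le hfa hfb _).trans ?_
    gcongr
    by_cases h2 : r + s + 2 ≤ m
    · exact tsum_tsum_bracket_le_of_left_sup ha hb h2 (by omega)
    · exact tsum_tsum_bracket_le_of_right_sup ha hb (by omega) (by omega)

end bilinear

lemma ae_fourierWeight_mul_enorm_iteratedDeriv_conv_le {σ : ℝ} (hσ : 0 < σ) {m p : ℕ} (q : ℕ)
    (hp : p ≤ m) {a b : ℤ → ℝ → ℂ} (ha : ∀ k, ContDiff ℝ m (a k)) (hb : ∀ k, ContDiff ℝ m (b k))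
    (hYa : YcSq σ m a < ⊤) (hYb : YcSq σ m b < ⊤) (k : ℤ) :
    ∀ᵐ t ∂(volume.restrict (Set.Icc (0 : ℝ) 1)),
      fourierWeight σ q k * ‖iteratedDeriv p (conv a b k) t‖ₑ ≤
        2 ^ p * 2 ^ q * ∑ r ∈ Finset.range (p + 1),
        (∑' j, weightedCoeff σ r q a j t * weightedCoeff σ (p - r) 0 b (k - j) t +
          ∑' j, weightedCoeff σ r 0 a j t * weightedCoeff σ (p - r) q b (k - j) t) := by
  filter_upwards [ae_enorm_iteratedDeriv_conv_le ha hb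
    (fun r hr => tsum_derivEnergy_ne_top hσ hr hYa)
    (fun r hr => tsum_derivEnergy_ne_top hσ hr hYb) hp k] with t ht
  refine (mul_le_mul' le_rfl ht).trans ?_
  rw [Finset.mul_sum, Finset.mul_sum]
  refine Finset.sum_le_sum fun r _ => ?_
  have hchoose : (p.choose r : ℝ≥0∞) ≤ 2 ^ p := by exact_mod_cast Nat.choose_le_two_pow p r
  rw [mul_left_comm, mul_assoc (2 ^ p)]
  refine mul_le_mul' hchoose ?_
  rw [← ENNReal.tsum_mul_left, ← ENNReal.tsum_add, ← ENNReal.tsum_mul_left]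
  refine ENNReal.tsum_le_tsum fun j => (mul_le_mul' (fourierWeight_le hσ q k j) le_rfl).trans_eq ?_
  simp only [weightedCoeff]
  ring

lemma levelSq_conv_le {σ : ℝ} (hσ : 0 < σ) {m p q : ℕ} (hm : 1 < m) (hpq : p + q ≤ m)
    {a b : ℤ → ℝ → ℂ} (ha : ∀ k, ContDiff ℝ m (a k)) (hb : ∀ k, ContDiff ℝ m (b k))
    (hYa : YcSq σ m a < ⊤) (hYb : YcSq σ m b < ⊤) :
    levelSq σ p q (conv a b) ≤ ((2 ^ p * 2 ^ q) ^ 2 * (p + 1) ^ 2 * 64 *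
      ∑' j, (bracket j)⁻¹ ^ 2) * (YcSq σ m a * YcSq σ m b) := by
  set S := ∑' j, (bracket j)⁻¹ ^ 2
  set P : ℕ → ℤ → ℝ → ℝ≥0∞ := fun r k t =>
    ∑' j, weightedCoeff σ r q a j t * weightedCoeff σ (p - r) 0 b (k - j) t
  set Q : ℕ → ℤ → ℝ → ℝ≥0∞ := fun r k t =>
    ∑' j, weightedCoeff σ r 0 a j t * weightedCoeff σ (p - r) q b (k - j) t
  have hP : ∀ r ∈ Finset.range (p + 1), ∀ k, Measurable (P r k) := fun r hr k => by
    have := Finset.mem_range.1 hr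
    exact Measurable.tsum fun j => (measurable_weightedCoeff ha (by omega) j).mul
      (measurable_weightedCoeff hb (by omega) (k - j))
  have hQ : ∀ r ∈ Finset.range (p + 1), ∀ k, Measurable (Q r k) := fun r hr k => by
    have := Finset.mem_range.1 hr
    exact Measurable.tsum fun j => (measurable_weightedCoeff ha (by omega) j).mul
      (measurable_weightedCoeff hb (by omega) (k - j))
  have hterm (k : ℤ) : fourierWeight σ q k ^ 2 * derivEnergy p (conv a b k) ≤
      ((2 ^ p * 2 ^ q) ^ 2 * ((p + 1) * 2)) * ∑ r ∈ Finset.range (p + 1),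
        ((∫⁻ t in Set.Icc (0 : ℝ) 1, P r k t ^ 2) + (∫⁻ t in Set.Icc (0 : ℝ) 1, Q r k t ^ 2)) := by
    rw [← lintegral_weightedCoeff_sq]
    calc _ ≤ ∫⁻ t in Set.Icc (0 : ℝ) 1, ((2 ^ p * 2 ^ q) ^ 2 * ((p + 1) * 2)) *
          ∑ r ∈ Finset.range (p + 1), (P r k t ^ 2 + Q r k t ^ 2) := by
          refine lintegral_mono_ae ?_
          filter_upwards [ae_fourierWeight_mul_enorm_iteratedDeriv_conv_le hσ q
            (show p ≤ m by omega) ha hb hYa hYb k] with t ht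
          refine (pow_le_pow_left' ht 2).trans ?_
          rw [mul_pow, mul_assoc (_ ^ 2)]
          gcongr
          refine (ennreal_sum_sq_le _ _).trans ?_
          rw [Finset.card_range, mul_assoc, Finset.mul_sum _ _ (2 : ℝ≥0∞)]
          push_cast
          gcongr
          exact ennreal_add_sq_le _ _
      _ = _ := by
        rw [lintegral_const_mul' _ _ (by finiteness), lintegral_finsetSum']
        swap
        · exact fun r hr =>
            (((hP r hr k).pow_const 2).add ((hQ r hr k).pow_const 2)).aemeasurable
        congr 1
        exact Finset.sum_congr rfl fun r hr => lintegral_add_left ((hP r hr k).pow_const 2) _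
  calc levelSq σ p q (conv a b) ≤ ∑' k, ((2 ^ p * 2 ^ q) ^ 2 * ((p + 1) * 2)) *
        ∑ r ∈ Finset.range (p + 1),
        ((∫⁻ t in Set.Icc (0 : ℝ) 1, P r k t ^ 2) + (∫⁻ t in Set.Icc (0 : ℝ) 1, Q r k t ^ 2)) :=
        ENNReal.tsum_le_tsum hterm
    _ = ((2 ^ p * 2 ^ q) ^ 2 * ((p + 1) * 2)) * ∑ r ∈ Finset.range (p + 1),
        (∑' k, (∫⁻ t in Set.Icc (0 : ℝ) 1, P r k t ^ 2) +
          ∑' k, (∫⁻ t in Set.Icc (0 : ℝ) 1, Q r k t ^ 2)) := by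
      rw [ENNReal.tsum_mul_left, Summable.tsum_finsetSum fun _ _ => ENNReal.summable]
      simp only [ENNReal.tsum_add]
    _ ≤ ((2 ^ p * 2 ^ q) ^ 2 * ((p + 1) * 2)) * ∑ r ∈ Finset.range (p + 1),
        (S * (16 * (YcSq σ m a * YcSq σ m b)) + S * (16 * (YcSq σ m a * YcSq σ m b))) := by
      gcongr with r hr
      all_goals
        have := Finset.mem_range.1 hr
        exact tsum_lintegral_weightedCoeff_convolution_sq_le hm ha hb (by omega)
    _ = _ := by
      rw [Finset.sum_const, Finset.card_range, nsmul_eq_mul]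
      push_cast
      ring

theorem Yσm_is_banach_algebra (σ : ℝ) (hσ : 0 < σ) (m : ℕ) (hm : 1 < m) :
    ∃ C > (0:ℝ), ∀ a b : ℤ → ℝ → ℂ,
      (∀ k, ContDiff ℝ m (a k)) → (∀ k, ContDiff ℝ m (b k)) →
      YcSq σ m a < ⊤ → YcSq σ m b < ⊤ →
      YcSq σ m (conv a b) ≤ ENNReal.ofReal (C^2) * (YcSq σ m a * YcSq σ m b) := by
  set S := ∑' j, (bracket j)⁻¹ ^ 2
  set K : ℝ≥0∞ := ∑ p ∈ Finset.range (m + 1), ∑ q ∈ Finset.range (m + 1 - p),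
    (2 ^ p * 2 ^ q) ^ 2 * (p + 1) ^ 2 * 64 * S
  have hK : K ≠ ∞ := by
    have hS : S ≠ ∞ := tsum_bracket_inv_sq_ne_top
    refine ENNReal.sum_ne_top.2 fun p _ => ENNReal.sum_ne_top.2 fun q _ => ?_
    finiteness
  refine ⟨√(K.toReal + 1), by positivity, fun a b ha hb hYa hYb => ?_⟩
  rw [Real.sq_sqrt (by positivity)]
  calc YcSq σ m (conv a b) ≤ K * (YcSq σ m a * YcSq σ m b) := by
        rw [YcSq_eq_sum_levelSq, Finset.sum_mul]
        refine Finset.sum_le_sum fun p hp => ?_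
        rw [Finset.sum_mul]
        refine Finset.sum_le_sum fun q hq => ?_
        have h1 := Finset.mem_range.1 hp
        have h2 := Finset.mem_range.1 hq
        exact levelSq_conv_le hσ hm (by omega) ha hb hYa hYb
    _ ≤ _ := by
      gcongr
      rw [ENNReal.le_ofReal_iff_toReal_le hK (by positivity)]
      linarith
end

section
/- The operator a ↦ (−Δa, a(·,0), a(·,1)) is a Banach space isomorphism from Y_σ^m(Π) onto Y_σ^{m−2}(Π) × X_σ^{m−1/2}(T) × X_σ^{m−1/2}(T): it is bounded, and for every (f, b, c) in the target space the Dirichlet problem Δa = f, a(·,0) = b, a(·,1) = c has a unique solution a ∈ Y_σ^m(Π) with ‖a‖²_{Y_σ^m} ≤ C(‖f‖²_{Y_σ^{m−2}} + ‖b‖²_{X_σ^{m−1/2}} + ‖c‖²_{X_σ^{m−1/2}}). -/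
open MeasureTheory
open scoped ENNReal NNReal

/-- squared X_σ^s norm -/
noncomputable def XSq (σ s : ℝ) (c : ℤ → ℂ) : ℝ≥0∞ :=
  ∑' k : ℤ, ENNReal.ofReal ((1 + (k:ℝ)^2) ^ s * Real.exp (2 * σ * |(k:ℝ)|)) *
    (‖c k‖₊ : ℝ≥0∞) ^ 2

open Set intervalIntegral

/-- The squared `L²(0,1)` norm. -/
noncomputable def l2Sq (u : ℝ → ℂ) : ℝ := ∫ t in (0:ℝ)..1, ‖u t‖ ^ 2

/-- The contribution of the frequency `x` to the squared `Y^m` norm, without the exponential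
weight. -/
noncomputable def modeSq (m : ℕ) (x : ℝ) (u : ℝ → ℂ) : ℝ :=
  ∑ p ∈ Finset.range (m + 1), ∑ q ∈ Finset.range (m + 1 - p),
    x ^ (2 * q) * l2Sq (iteratedDeriv p u)

lemma l2Sq_nonneg (u : ℝ → ℂ) : 0 ≤ l2Sq u :=
  integral_nonneg zero_le_one fun _ _ => by positivity

lemma integral_unitInterval_mono {φ ψ : ℝ → ℝ} (hφ : Continuous φ) (hψ : Continuous ψ)
    (h : ∀ t ∈ Icc (0:ℝ) 1, φ t ≤ ψ t) : ∫ t in (0:ℝ)..1, φ t ≤ ∫ t in (0:ℝ)..1, ψ t :=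
  integral_mono_on zero_le_one (hφ.intervalIntegrable _ _) (hψ.intervalIntegrable _ _) h

lemma integral_lin_comb_l2Sq {u v : ℝ → ℂ} (hu : Continuous u) (hv : Continuous v) (α β : ℝ) :
    ∫ t in (0:ℝ)..1, (α * ‖u t‖ ^ 2 + β * ‖v t‖ ^ 2) = α * l2Sq u + β * l2Sq v := by
  rw [intervalIntegral.integral_add, intervalIntegral.integral_const_mul,
    intervalIntegral.integral_const_mul]
  · rfl
  · exact Continuous.intervalIntegrable (by fun_prop) _ _
  · exact Continuous.intervalIntegrable (by fun_prop) _ _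

/-- If `‖w‖ ≤ α‖u‖ + β‖v‖` on `[0,1]`, the squared norms compare accordingly. -/
lemma l2Sq_le_of_norm_le {u v w : ℝ → ℂ} (hu : Continuous u) (hv : Continuous v)
    (hw : Continuous w) {α β : ℝ}
    (h : ∀ t ∈ Icc (0:ℝ) 1, ‖w t‖ ≤ α * ‖u t‖ + β * ‖v t‖) :
    l2Sq w ≤ 2 * α ^ 2 * l2Sq u + 2 * β ^ 2 * l2Sq v := by
  rw [← integral_lin_comb_l2Sq hu hv]
  refine integral_unitInterval_mono (by fun_prop) (by fun_prop) fun t ht => ?_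
  have h1 := pow_le_pow_left₀ (norm_nonneg _) (h t ht) 2
  nlinarith [sq_nonneg (α * ‖u t‖ - β * ‖v t‖)]

lemma l2Sq_congr {u v : ℝ → ℂ} (h : EqOn u v (Icc 0 1)) : l2Sq u = l2Sq v := by
  refine integral_congr fun t ht => ?_
  rw [uIcc_of_le zero_le_one] at ht
  simp only [h ht]

lemma eqOn_zero_of_l2Sq_nonpos {u : ℝ → ℂ} (hu : Continuous u) (h : l2Sq u ≤ 0) :
    EqOn u 0 (Icc 0 1) := by
  intro t ht
  by_contra hne
  refine absurd h (not_le.2 ?_)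
  refine integral_pos zero_lt_one (by fun_prop) (fun _ _ => by positivity) ⟨t, ht, ?_⟩
  have : u t ≠ 0 := hne
  positivity

lemma two_mul_inner_le (z w : ℂ) {s μ : ℝ} (hs : |s| ≤ 1) (hμ : 0 < μ) :
    2 * s * inner ℝ z w ≤ μ * ‖z‖ ^ 2 + μ⁻¹ * ‖w‖ ^ 2 := by
  have h1 : s * inner ℝ z w ≤ ‖z‖ * ‖w‖ := by
    refine (le_abs_self _).trans ?_
    rw [abs_mul]
    have := abs_real_inner_le_norm z w
    nlinarith [abs_nonneg (inner ℝ z w), abs_nonneg s]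
  have h2 : μ * ‖z‖ ^ 2 + μ⁻¹ * ‖w‖ ^ 2 - 2 * (‖z‖ * ‖w‖) = μ⁻¹ * (μ * ‖z‖ - ‖w‖) ^ 2 := by
    field_simp
    ring
  have h3 : 0 ≤ μ⁻¹ * (μ * ‖z‖ - ‖w‖) ^ 2 := by positivity
  linarith

/-- Integration of `((t - s) ‖u‖²)'` over `[0,1]`. -/
lemma integral_weighted_normSq {u v : ℝ → ℂ} (hu : ∀ t, HasDerivAt u (v t) t)
    (hv : Continuous v) (s : ℝ) :
    (1 - s) * ‖u 1‖ ^ 2 + s * ‖u 0‖ ^ 2 =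
      l2Sq u + ∫ t in (0:ℝ)..1, 2 * (t - s) * inner ℝ (u t) (v t) := by
  have huc : Continuous u := continuous_iff_continuousAt.2 fun t => (hu t).continuousAt
  have hd : ∀ t, HasDerivAt (fun t => (t - s) * ‖u t‖ ^ 2)
      (‖u t‖ ^ 2 + 2 * (t - s) * inner ℝ (u t) (v t)) t := fun t => by
    refine (((hasDerivAt_id t).sub_const s).mul (hu t).norm_sq).congr_deriv ?_
    simp only [id]
    ring
  have h := integral_eq_sub_of_hasDerivAt (a := 0) (b := 1) (fun t _ => hd t)
    (Continuous.intervalIntegrable (by fun_prop) _ _)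
  rw [intervalIntegral.integral_add (Continuous.intervalIntegrable (by fun_prop) _ _)
    (Continuous.intervalIntegrable (by fun_prop) _ _)] at h
  rw [l2Sq, h]
  ring

lemma integral_weighted_inner_le {u v : ℝ → ℂ} (hu : Continuous u) (hv : Continuous v)
    {s μ : ℝ} (hs : s ∈ Icc (0:ℝ) 1) (hμ : 0 < μ) :
    ∫ t in (0:ℝ)..1, 2 * (t - s) * inner ℝ (u t) (v t) ≤ μ * l2Sq u + μ⁻¹ * l2Sq v := by
  rw [← integral_lin_comb_l2Sq hu hv]
  refine integral_unitInterval_mono (by fun_prop) (by fun_prop) fun t ht => ?_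
  refine two_mul_inner_le _ _ ?_ hμ
  rw [abs_le]
  constructor <;> linarith [ht.1, ht.2, hs.1, hs.2]

lemma normSq_trace_le {u v : ℝ → ℂ} (hu : ∀ t, HasDerivAt u (v t) t) (hv : Continuous v)
    {s μ : ℝ} (hs : s ∈ Icc (0:ℝ) 1) (hμ : 0 < μ) :
    (1 - s) * ‖u 1‖ ^ 2 + s * ‖u 0‖ ^ 2 ≤ (1 + μ) * l2Sq u + μ⁻¹ * l2Sq v := by
  have huc : Continuous u := continuous_iff_continuousAt.2 fun t => (hu t).continuousAt
  rw [integral_weighted_normSq hu hv s]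
  linarith [integral_weighted_inner_le huc hv hs hμ]

/-- Poincaré inequality. -/
lemma l2Sq_le_of_vanish {u v : ℝ → ℂ} (hu : ∀ t, HasDerivAt u (v t) t) (hv : Continuous v)
    (h0 : u 0 = 0) : l2Sq u ≤ 4 * l2Sq v := by
  have huc : Continuous u := continuous_iff_continuousAt.2 fun t => (hu t).continuousAt
  have h1 := integral_weighted_normSq hu hv 1
  have h2 := integral_weighted_inner_le huc.neg hv (s := 1) (μ := 1/2) (by simp) (by norm_num)
  have h3 : l2Sq (-u) = l2Sq u := by simp [l2Sq]
  rw [h3] at h2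
  simp only [Pi.neg_apply, inner_neg_left, mul_neg, intervalIntegral.integral_neg] at h2
  simp only [h0, sub_self, norm_zero] at h1
  norm_num at h1 h2
  linarith

/-- Energy estimate for `u'' - x² u = g` with homogeneous Dirichlet data. -/
lemma dirichlet_energy {u v w : ℝ → ℂ} (hu : ∀ t, HasDerivAt u (v t) t)
    (hv : ∀ t, HasDerivAt v (w t) t) (hw : Continuous w) (x : ℝ) (h0 : u 0 = 0) (h1 : u 1 = 0) :
    (1 + x ^ 2) ^ 2 * l2Sq u ≤ 16 * l2Sq (fun t => w t - (x:ℂ) ^ 2 * u t) ∧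
      (1 + x ^ 2) * l2Sq v ≤ 4 * l2Sq (fun t => w t - (x:ℂ) ^ 2 * u t) := by
  have huc : Continuous u := continuous_iff_continuousAt.2 fun t => (hu t).continuousAt
  have hvc : Continuous v := continuous_iff_continuousAt.2 fun t => (hv t).continuousAt
  set g : ℝ → ℂ := fun t => w t - (x:ℂ) ^ 2 * u t with hg
  have hgc : Continuous g := by fun_prop
  have hP := l2Sq_le_of_vanish hu hvc h0
  have hu0 := l2Sq_nonneg u
  have hv0 := l2Sq_nonneg v
  have hd : ∀ t, HasDerivAt (fun t => inner ℝ (u t) (v t))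
      ((x ^ 2 * ‖u t‖ ^ 2 + 1 * ‖v t‖ ^ 2) + inner ℝ (u t) (g t)) t := fun t => by
    refine ((hu t).inner ℝ (hv t)).congr_deriv ?_
    have : w t = (x ^ 2 : ℝ) • u t + g t := by
      simp only [hg, Complex.real_smul]
      push_cast
      ring
    rw [this, inner_add_right, inner_smul_right, real_inner_self_eq_norm_sq,
      real_inner_self_eq_norm_sq]
    ring
  have hI := integral_eq_sub_of_hasDerivAt (a := 0) (b := 1) (fun t _ => hd t)
    (Continuous.intervalIntegrable (by fun_prop) _ _)
  rw [intervalIntegral.integral_add (Continuous.intervalIntegrable (by fun_prop) _ _)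
    (Continuous.intervalIntegrable (by fun_prop) _ _), integral_lin_comb_l2Sq huc hvc, h0, h1,
    inner_zero_left, inner_zero_left, sub_self] at hI
  set y := 1 + x ^ 2 with hy
  have hypos : 0 < y := by positivity
  have hY : ∫ t in (0:ℝ)..1, -(2 * inner ℝ (u t) (g t)) ≤
      (y / 4) * l2Sq u + (y / 4)⁻¹ * l2Sq g := by
    rw [← integral_lin_comb_l2Sq huc hgc]
    refine integral_unitInterval_mono (by fun_prop) (by fun_prop) fun t ht => ?_
    have := two_mul_inner_le (u t) (g t) (s := -1) (μ := y / 4) (by simp) (by positivity)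
    linarith
  rw [intervalIntegral.integral_neg, intervalIntegral.integral_const_mul] at hY
  have e1 : y * ((y / 4)⁻¹ * l2Sq g) = 4 * l2Sq g := by field_simp
  have hx : 0 ≤ x ^ 2 * l2Sq u := by positivity
  have hyu : y * l2Sq u ≤ 4 * (x ^ 2 * l2Sq u + l2Sq v) := by
    rw [hy]; linarith
  have hE : x ^ 2 * l2Sq u + l2Sq v ≤ (y / 4)⁻¹ * l2Sq g := by linarith
  have hE' := mul_le_mul_of_nonneg_left hE hypos.le
  rw [e1] at hE'
  constructor
  · nlinarith
  · nlinarith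

/-- Functions concentrated near the endpoints at scale `1 / K` have small `L²` norm. -/
lemma l2Sq_boundary_layer_le {h : ℝ → ℂ} (hh : Continuous h) {K M N : ℝ} (hK : 0 ≤ K)
    (hle : ∀ t ∈ Icc (0:ℝ) 1,
      ‖h t‖ ≤ M * Real.exp (-K * t) + N * Real.exp (-K * (1 - t))) :
    (1 + K) * l2Sq h ≤ 4 * (M ^ 2 + N ^ 2) := by
  set e : ℝ → ℝ := fun t => Real.exp (-2 * K * t) with he
  have hec : Continuous e := by fun_prop
  have hI1 : ∫ t in (0:ℝ)..1, e t ≤ 1 := by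
    have : ∫ t in (0:ℝ)..1, e t ≤ ∫ t in (0:ℝ)..1, (1:ℝ) := by
      refine integral_unitInterval_mono hec continuous_const fun t ht => ?_
      refine Real.exp_le_one_iff.2 ?_
      nlinarith [mul_nonneg hK ht.1]
    simpa using this
  have hI2 : K * ∫ t in (0:ℝ)..1, e t ≤ 1 := by
    have hd : ∀ t, HasDerivAt (fun t => -(1/2) * e t) (K * e t) t := fun t => by
      refine ((((hasDerivAt_id t).const_mul (-2 * K)).exp).const_mul (-(1/2))).congr_deriv ?_
      simp only [he, id]
      ring
    rw [← intervalIntegral.integral_const_mul,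
      integral_eq_sub_of_hasDerivAt (fun t _ => hd t)
        (Continuous.intervalIntegrable (by fun_prop) _ _)]
    simp only [he]
    have := Real.exp_pos (-2 * K * 1)
    simp only [mul_zero, Real.exp_zero]
    linarith
  have hrefl : ∫ t in (0:ℝ)..1, e (1 - t) = ∫ t in (0:ℝ)..1, e t := by
    rw [intervalIntegral.integral_comp_sub_left (fun t => e t) 1]
    simp
  have hle' : l2Sq h ≤ 2 * M ^ 2 * (∫ t in (0:ℝ)..1, e t) + 2 * N ^ 2 * ∫ t in (0:ℝ)..1, e t := by
    calc l2Sq h ≤ ∫ t in (0:ℝ)..1, (2 * M ^ 2 * e t + 2 * N ^ 2 * e (1 - t)) := by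
          refine integral_unitInterval_mono (by fun_prop) (by fun_prop) fun t ht => ?_
          have h1 := pow_le_pow_left₀ (norm_nonneg _) (hle t ht) 2
          have e1 : e t = Real.exp (-K * t) ^ 2 := by
            simp only [he]; rw [← Real.exp_nat_mul]; congr 1; push_cast; ring
          have e2 : e (1 - t) = Real.exp (-K * (1 - t)) ^ 2 := by
            simp only [he]; rw [← Real.exp_nat_mul]; congr 1; push_cast; ring
          rw [e1, e2]
          nlinarith [sq_nonneg (M * Real.exp (-K * t) - N * Real.exp (-K * (1 - t)))]
      _ = _ := by
          rw [intervalIntegral.integral_add (Continuous.intervalIntegrable (by fun_prop) _ _)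
            (Continuous.intervalIntegrable (by fun_prop) _ _),
            intervalIntegral.integral_const_mul, intervalIntegral.integral_const_mul, hrefl]
  have hS : 0 ≤ M ^ 2 + N ^ 2 := by positivity
  calc (1 + K) * l2Sq h
      ≤ (1 + K) * (2 * M ^ 2 * (∫ t in (0:ℝ)..1, e t) + 2 * N ^ 2 * ∫ t in (0:ℝ)..1, e t) :=
        mul_le_mul_of_nonneg_left hle' (by linarith)
    _ = 2 * (M ^ 2 + N ^ 2) * ((∫ t in (0:ℝ)..1, e t) + K * ∫ t in (0:ℝ)..1, e t) := by ring
    _ ≤ 2 * (M ^ 2 + N ^ 2) * (1 + 1) := by gcongr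
    _ = _ := by ring

/-- A smooth function with boundary values `b` at `0` and `c` at `1`. -/
noncomputable def boundaryLift (K : ℝ) (b c : ℂ) (t : ℝ) : ℂ :=
  (Real.exp (-K * t) * (1 - t) : ℝ) * b + (Real.exp (-K * (1 - t)) * t : ℝ) * c

/-- The derivative of `boundaryLift`. -/
noncomputable def boundaryLiftDeriv (K : ℝ) (b c : ℂ) (t : ℝ) : ℂ :=
  (-(Real.exp (-K * t) * (K * (1 - t) + 1)) : ℝ) * b +
    (Real.exp (-K * (1 - t)) * (K * t + 1) : ℝ) * c

lemma hasDerivAt_boundaryLift (K : ℝ) (b c : ℂ) (t : ℝ) :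
    HasDerivAt (boundaryLift K b c) (boundaryLiftDeriv K b c t) t := by
  have h1 : HasDerivAt (fun t : ℝ => Real.exp (-K * t) * (1 - t))
      (-(Real.exp (-K * t) * (K * (1 - t) + 1))) t := by
    refine ((((hasDerivAt_id t).const_mul (-K)).exp).mul
      ((hasDerivAt_id t).const_sub 1)).congr_deriv ?_
    simp only [id]; ring
  have h2 : HasDerivAt (fun t : ℝ => Real.exp (-K * (1 - t)) * t)
      (Real.exp (-K * (1 - t)) * (K * t + 1)) t := by
    refine (((((hasDerivAt_id t).const_sub 1).const_mul (-K)).exp).mul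
      (hasDerivAt_id t)).congr_deriv ?_
    simp only [id]; ring
  exact (h1.ofReal_comp.mul_const b).add (h2.ofReal_comp.mul_const c)

lemma hasDerivAt_boundaryLiftDeriv (K : ℝ) (b c : ℂ) (t : ℝ) :
    HasDerivAt (boundaryLiftDeriv K b c)
      ((K:ℂ) ^ 2 * boundaryLift K b c t + ((2 * K * Real.exp (-K * t) : ℝ) * b +
        (2 * K * Real.exp (-K * (1 - t)) : ℝ) * c)) t := by
  have h1 : HasDerivAt (fun t : ℝ => -(Real.exp (-K * t) * (K * (1 - t) + 1)))
      (K ^ 2 * (Real.exp (-K * t) * (1 - t)) + 2 * K * Real.exp (-K * t)) t := by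
    refine ((((hasDerivAt_id t).const_mul (-K)).exp).mul
      ((((hasDerivAt_id t).const_sub 1).const_mul K).add_const 1)).neg.congr_deriv ?_
    simp only [id]; ring
  have h2 : HasDerivAt (fun t : ℝ => Real.exp (-K * (1 - t)) * (K * t + 1))
      (K ^ 2 * (Real.exp (-K * (1 - t)) * t) + 2 * K * Real.exp (-K * (1 - t))) t := by
    refine (((((hasDerivAt_id t).const_sub 1).const_mul (-K)).exp).mul
      (((hasDerivAt_id t).const_mul K).add_const 1)).congr_deriv ?_
    simp only [id]; ring
  refine ((h1.ofReal_comp.mul_const b).add (h2.ofReal_comp.mul_const c)).congr_deriv ?_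
  simp only [boundaryLift]
  push_cast
  ring

lemma norm_real_comb_le (α β M N : ℝ) (b c : ℂ) (hα : |α| ≤ M) (hβ : |β| ≤ N) :
    ‖(α : ℂ) * b + (β : ℂ) * c‖ ≤ M * ‖b‖ + N * ‖c‖ := by
  refine (norm_add_le _ _).trans ?_
  rw [norm_mul, norm_mul, Complex.norm_real, Complex.norm_real, Real.norm_eq_abs,
    Real.norm_eq_abs]
  gcongr

/-- A-priori estimate for `a'' - x² a = f` in terms of `f` and the boundary values of `a`. -/
lemma dirichlet_apriori {a v w : ℝ → ℂ} (ha : ∀ t, HasDerivAt a (v t) t)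
    (hv : ∀ t, HasDerivAt v (w t) t) (hw : Continuous w) (x : ℝ) :
    (1 + x ^ 2) ^ 2 * l2Sq a ≤ 4000 * (l2Sq (fun t => w t - (x:ℂ) ^ 2 * a t) +
        (1 + x ^ 2) * √(1 + x ^ 2) * (‖a 0‖ ^ 2 + ‖a 1‖ ^ 2)) ∧
      (1 + x ^ 2) * l2Sq v ≤ 4000 * (l2Sq (fun t => w t - (x:ℂ) ^ 2 * a t) +
        (1 + x ^ 2) * √(1 + x ^ 2) * (‖a 0‖ ^ 2 + ‖a 1‖ ^ 2)) := by
  have hac : Continuous a := continuous_iff_continuousAt.2 fun t => (ha t).continuousAt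
  have hvc : Continuous v := continuous_iff_continuousAt.2 fun t => (hv t).continuousAt
  set K := |x|
  have hK : 0 ≤ K := abs_nonneg x
  have hKx : K ^ 2 = x ^ 2 := sq_abs x
  have hKxC : (K:ℂ) ^ 2 = (x:ℂ) ^ 2 := by exact_mod_cast congrArg (fun r : ℝ => (r:ℂ)) hKx
  set b := a 0
  set c := a 1
  set S := ‖b‖ ^ 2 + ‖c‖ ^ 2 with hS
  have hS0 : 0 ≤ S := by positivity
  set g := boundaryLift K b c with hg
  set g' := boundaryLiftDeriv K b c
  set G : ℝ → ℂ := fun t => (2 * K * Real.exp (-K * t) : ℝ) * b +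
    (2 * K * Real.exp (-K * (1 - t)) : ℝ) * c with hG
  have hgc : Continuous g :=
    continuous_iff_continuousAt.2 fun t => (hasDerivAt_boundaryLift K b c t).continuousAt
  have hgc' : Continuous g' :=
    continuous_iff_continuousAt.2 fun t => (hasDerivAt_boundaryLiftDeriv K b c t).continuousAt
  have hGc : Continuous G := by fun_prop
  have hfc : Continuous fun t => w t - (x:ℂ) ^ 2 * a t := by fun_prop
  have bg : (1 + K) * l2Sq g ≤ 4 * S := by
    refine l2Sq_boundary_layer_le hgc hK fun t ht => ?_
    refine (norm_real_comb_le _ _ (Real.exp (-K * t)) (Real.exp (-K * (1 - t))) b c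
      ?_ ?_).trans_eq (by ring)
    · rw [abs_of_nonneg (mul_nonneg (Real.exp_pos _).le (by linarith [ht.2]))]
      exact mul_le_of_le_one_right (Real.exp_pos _).le (by linarith [ht.1])
    · rw [abs_of_nonneg (mul_nonneg (Real.exp_pos _).le ht.1)]
      exact mul_le_of_le_one_right (Real.exp_pos _).le ht.2
  have bg' : (1 + K) * l2Sq g' ≤ 4 * ((1 + K) ^ 2 * S) := by
    refine (l2Sq_boundary_layer_le (M := (1 + K) * ‖b‖) (N := (1 + K) * ‖c‖) hgc' hK
      fun t ht => ?_).trans_eq (by rw [hS]; ring)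
    have h1 : 0 ≤ K * (1 - t) := mul_nonneg hK (by linarith [ht.2])
    have h2 : 0 ≤ K * t := mul_nonneg hK ht.1
    refine (norm_real_comb_le _ _ (Real.exp (-K * t) * (1 + K))
      (Real.exp (-K * (1 - t)) * (1 + K)) b c ?_ ?_).trans_eq (by ring)
    · rw [abs_neg, abs_of_nonneg (mul_nonneg (Real.exp_pos _).le (by linarith))]
      exact mul_le_mul_of_nonneg_left (by linarith) (Real.exp_pos _).le
    · rw [abs_of_nonneg (mul_nonneg (Real.exp_pos _).le (by linarith))]
      exact mul_le_mul_of_nonneg_left (by linarith) (Real.exp_pos _).le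
  have bG : (1 + K) * l2Sq G ≤ 4 * ((2 * K) ^ 2 * S) := by
    refine (l2Sq_boundary_layer_le (M := (2 * K) * ‖b‖) (N := (2 * K) * ‖c‖) hGc hK
      fun t ht => ?_).trans_eq (by rw [hS]; ring)
    refine (norm_real_comb_le _ _ (2 * K * Real.exp (-K * t))
      (2 * K * Real.exp (-K * (1 - t))) b c ?_ ?_).trans_eq (by ring) <;>
    · rw [abs_of_nonneg (by positivity)]
  have hE := dirichlet_energy (u := fun t => a t - g t) (v := fun t => v t - g' t)
    (w := fun t => w t - ((K:ℂ) ^ 2 * g t + G t))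
    (fun t => (ha t).sub (hasDerivAt_boundaryLift K b c t))
    (fun t => (hv t).sub (hasDerivAt_boundaryLiftDeriv K b c t))
    (by fun_prop) x (by simp [hg, boundaryLift, b]) (by simp [hg, boundaryLift, c])
  have hfe : (fun t => w t - ((K:ℂ) ^ 2 * g t + G t) - (x:ℂ) ^ 2 * (a t - g t)) =
      fun t => (w t - (x:ℂ) ^ 2 * a t) - G t := by
    funext t; rw [hKxC]; ring
  rw [hfe] at hE
  set F := l2Sq (fun t => w t - (x:ℂ) ^ 2 * a t)
  have b1 : l2Sq (fun t => (w t - (x:ℂ) ^ 2 * a t) - G t) ≤ 2 * F + 2 * l2Sq G := by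
    have := l2Sq_le_of_norm_le (α := 1) (β := 1) hfc hGc (hfc.sub hGc) fun t _ => by
      simpa using norm_sub_le (w t - (x:ℂ) ^ 2 * a t) (G t)
    rwa [one_pow, mul_one] at this
  have b2 : l2Sq a ≤ 2 * l2Sq (fun t => a t - g t) + 2 * l2Sq g := by
    have := l2Sq_le_of_norm_le (α := 1) (β := 1) (hac.sub hgc) hgc hac fun t _ => by
      simpa using norm_add_le (a t - g t) (g t)
    rwa [one_pow, mul_one] at this
  have b3 : l2Sq v ≤ 2 * l2Sq (fun t => v t - g' t) + 2 * l2Sq g' := by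
    have := l2Sq_le_of_norm_le (α := 1) (β := 1) (hvc.sub hgc') hgc' hvc fun t _ => by
      simpa using norm_add_le (v t - g' t) (g' t)
    rwa [one_pow, mul_one] at this
  have hF0 : 0 ≤ F := l2Sq_nonneg _
  set y := 1 + x ^ 2 with hy
  have hy1 : 1 ≤ y := by rw [hy]; nlinarith [sq_nonneg x]
  set r := √y with hr
  have hr2 : r ^ 2 = y := Real.sq_sqrt (by linarith)
  have hr1 : 1 ≤ r := Real.one_le_sqrt.2 hy1
  have hrK : r ≤ 1 + K := by
    rw [hr]
    refine Real.sqrt_le_iff.2 ⟨by linarith, ?_⟩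
    rw [hy, ← hKx]; nlinarith
  have hKr : 1 + K ≤ 2 * r := by
    have : K ≤ r := by
      refine Real.le_sqrt_of_sq_le ?_
      rw [hy, hKx]; linarith
    linarith
  have hpos : 0 < 1 + K := by linarith
  have c1 : y ^ 2 * l2Sq g ≤ 4 * (y * r * S) := by
    have h1 : r * l2Sq g ≤ 4 * S :=
      (mul_le_mul_of_nonneg_right hrK (l2Sq_nonneg g)).trans bg
    calc y ^ 2 * l2Sq g = y * r * (r * l2Sq g) := by rw [← hr2]; ring
      _ ≤ y * r * (4 * S) := by gcongr
      _ = _ := by ring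
  have c2 : y * l2Sq g' ≤ 8 * (y * r * S) := by
    have h1 : l2Sq g' ≤ 4 * ((1 + K) * S) := by
      refine le_of_mul_le_mul_left ?_ hpos
      linarith [bg']
    calc y * l2Sq g' ≤ y * (4 * ((1 + K) * S)) := by gcongr
      _ ≤ y * (4 * ((2 * r) * S)) := by gcongr
      _ = _ := by ring
  have c3 : l2Sq G ≤ 32 * (y * r * S) := by
    have h1 : l2Sq G ≤ 16 * ((1 + K) * S) := by
      refine le_of_mul_le_mul_left ?_ hpos
      refine bG.trans ?_
      nlinarith [mul_nonneg hK hS0]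
    calc l2Sq G ≤ 16 * ((1 + K) * S) := h1
      _ ≤ 16 * ((2 * r) * S) := by gcongr
      _ = 32 * (1 * r * S) := by ring
      _ ≤ _ := by gcongr
  have hT : 0 ≤ y * r * S := by positivity
  constructor
  · have := mul_le_mul_of_nonneg_left b2 (sq_nonneg y)
    linarith [hE.1]
  · have := mul_le_mul_of_nonneg_left b3 (by linarith : 0 ≤ y)
    linarith [hE.2]

lemma exists_firstOrder {n : ℕ} {g : ℝ → ℂ} (hg : ContDiff ℝ n g) (x : ℝ) (β : ℂ) :
    ∃ y : ℝ → ℂ, ContDiff ℝ (n + 1 : ℕ) y ∧ y 0 = β ∧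
      ∀ t, HasDerivAt y ((x:ℂ) * y t + g t) t := by
  set h : ℝ → ℂ := fun t => (Real.exp (-x * t) : ℝ) * g t with hh
  have hec : ∀ x : ℝ, ContDiff ℝ (n + 1 : ℕ) fun t : ℝ => ((Real.exp (x * t) : ℝ) : ℂ) :=
    fun x => Complex.ofRealCLM.contDiff.comp (contDiff_const.mul contDiff_id).exp
  have hhn : ContDiff ℝ n h := ((hec (-x)).of_le (by exact_mod_cast n.le_succ)).mul hg
  have hH : ∀ t, HasDerivAt (fun t => ∫ s in (0:ℝ)..t, h s) (h t) t := fun t =>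
    (hhn.continuous.integral_hasStrictDerivAt 0 t).hasDerivAt
  have hHn : ContDiff ℝ (n + 1 : ℕ) fun t => ∫ s in (0:ℝ)..t, h s := by
    push_cast
    refine contDiff_succ_iff_deriv.2 ⟨fun t => (hH t).differentiableAt, by simp, ?_⟩
    rwa [funext fun t => (hH t).deriv]
  refine ⟨fun t => (Real.exp (x * t) : ℝ) * (β + ∫ s in (0:ℝ)..t, h s),
    (hec x).mul (contDiff_const.add hHn), by simp, fun t => ?_⟩
  have he : HasDerivAt (fun t : ℝ => Real.exp (x * t)) (Real.exp (x * t) * x) t := by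
    simpa using ((hasDerivAt_id t).const_mul x).exp
  refine (he.ofReal_comp.mul ((hH t).const_add β)).congr_deriv ?_
  have hone : ((Real.exp (x * t) : ℝ) : ℂ) * ((Real.exp (-x * t) : ℝ) : ℂ) = 1 := by
    rw [← Complex.ofReal_mul, ← Real.exp_add]
    simp
  simp only [hh, Complex.ofReal_mul]
  linear_combination g t * hone

/-- Solvability of `a'' - x² a = f` with prescribed values at `0` and `1`. -/
lemma exists_dirichlet_solution {n : ℕ} {f : ℝ → ℂ} (hf : ContDiff ℝ n f) (x : ℝ) (b c : ℂ) :
    ∃ a v : ℝ → ℂ, ContDiff ℝ (n + 2 : ℕ) a ∧ (∀ t, HasDerivAt a (v t) t) ∧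
      (∀ t, HasDerivAt v ((x:ℂ) ^ 2 * a t + f t) t) ∧ a 0 = b ∧ a 1 = c := by
  have key : ∀ (g : ℝ → ℂ), ContDiff ℝ n g → ∀ β γ : ℂ, ∃ a v : ℝ → ℂ,
      ContDiff ℝ (n + 2 : ℕ) a ∧ (∀ t, HasDerivAt a (v t) t) ∧
      (∀ t, HasDerivAt v ((x:ℂ) ^ 2 * a t + g t) t) ∧ a 0 = β ∧ v 0 = γ - x * β := by
    intro g hg β γ
    obtain ⟨y, hy, hy0, hyd⟩ := exists_firstOrder hg x γ
    obtain ⟨a, ha, ha0, had⟩ := exists_firstOrder hy (-x) β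
    refine ⟨a, fun t => ((-x : ℝ) : ℂ) * a t + y t, ha, had, fun t => ?_, ha0, ?_⟩
    · refine (((had t).const_mul _).add (hyd t)).congr_deriv ?_
      push_cast
      ring
    · simp only [ha0, hy0]
      push_cast
      ring
  obtain ⟨a₁, v₁, ha₁, hav₁, hvw₁, h₁0, -⟩ := key f hf b 0
  obtain ⟨a₂, v₂, ha₂, hav₂, hvw₂, h₂0, hv₂0⟩ := key (fun _ => 0) contDiff_const 0 1
  have hne : a₂ 1 ≠ 0 := fun h₂1 => by
    have hE := (dirichlet_energy hav₂ hvw₂ (by have := ha₂.continuous; fun_prop) x h₂0 h₂1).2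
    have hz : l2Sq (fun t => (x:ℂ) ^ 2 * a₂ t + 0 - (x:ℂ) ^ 2 * a₂ t) = 0 := by simp [l2Sq]
    rw [hz] at hE
    have hv : l2Sq v₂ ≤ 0 := by nlinarith [l2Sq_nonneg v₂, sq_nonneg x]
    have hvc : Continuous v₂ := continuous_iff_continuousAt.2 fun t => (hvw₂ t).continuousAt
    have h0 := eqOn_zero_of_l2Sq_nonpos hvc hv (left_mem_Icc.2 zero_le_one)
    rw [hv₂0] at h0
    simp at h0
  set γ := (c - a₁ 1) / a₂ 1
  refine ⟨fun t => a₁ t + γ * a₂ t, fun t => v₁ t + γ * v₂ t, ha₁.add (contDiff_const.mul ha₂),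
    fun t => (hav₁ t).add ((hav₂ t).const_mul γ), fun t => ?_, by simp [h₁0, h₂0], ?_⟩
  · refine ((hvw₁ t).add ((hvw₂ t).const_mul γ)).congr_deriv ?_
    ring
  · simp only [γ]
    field_simp
    ring

lemma iteratedDeriv_helmholtz {n p : ℕ} {a : ℝ → ℂ} (ha : ContDiff ℝ (n + 2 : ℕ) a) (z : ℂ)
    (hp : p ≤ n) :
    iteratedDeriv p (fun t => iteratedDeriv 2 a t - z * a t) =
      fun t => iteratedDeriv (p + 2) a t - z * iteratedDeriv p a t := by
  have h2 : ContDiff ℝ p (iteratedDeriv 2 a) := by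
    rw [iteratedDeriv_eq_iterate]
    exact ContDiff.iterate_deriv' p 2 (ha.of_le (by exact_mod_cast Nat.add_le_add_right hp 2))
  have h0 : ContDiff ℝ p a := ha.of_le (by exact_mod_cast (by omega : p ≤ n + 2))
  funext t
  rw [iteratedDeriv_fun_sub h2.contDiffAt (contDiff_const.mul h0).contDiffAt,
    iteratedDeriv_const_mul_field]
  simp only [iteratedDeriv_eq_iterate, Function.iterate_add_apply]

lemma pow_mul_l2Sq_le_modeSq {m p q : ℕ} (h : p + q ≤ m) (x : ℝ) (u : ℝ → ℂ) :
    x ^ (2 * q) * l2Sq (iteratedDeriv p u) ≤ modeSq m x u := by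
  have hnn : ∀ p q : ℕ, 0 ≤ x ^ (2 * q) * l2Sq (iteratedDeriv p u) := fun p q =>
    mul_nonneg (by rw [pow_mul]; positivity) (l2Sq_nonneg _)
  calc x ^ (2 * q) * l2Sq (iteratedDeriv p u)
      ≤ ∑ q ∈ Finset.range (m + 1 - p), x ^ (2 * q) * l2Sq (iteratedDeriv p u) :=
        Finset.single_le_sum (f := fun q => x ^ (2 * q) * l2Sq (iteratedDeriv p u))
          (fun q _ => hnn p q) (Finset.mem_range.2 (by omega))
    _ ≤ modeSq m x u :=
        Finset.single_le_sum (f := fun p => ∑ q ∈ Finset.range (m + 1 - p),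
          x ^ (2 * q) * l2Sq (iteratedDeriv p u))
          (fun p _ => Finset.sum_nonneg fun q _ => hnn p q) (Finset.mem_range.2 (by omega))

lemma modeSq_nonneg (m : ℕ) (x : ℝ) (u : ℝ → ℂ) : 0 ≤ modeSq m x u :=
  Finset.sum_nonneg fun _ _ => Finset.sum_nonneg fun _ _ =>
    mul_nonneg (by rw [pow_mul]; positivity) (l2Sq_nonneg _)

lemma japanese_pow_mul_l2Sq_le_modeSq {m p j : ℕ} (h : p + j ≤ m) (x : ℝ) (u : ℝ → ℂ) :
    (1 + x ^ 2) ^ j * l2Sq (iteratedDeriv p u) ≤ 2 ^ (m + 1) * modeSq m x u := by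
  have h1 : (1 + x ^ 2) ^ j ≤ 2 ^ m * (1 + x ^ (2 * j)) := by
    refine (add_pow_le zero_le_one (sq_nonneg x) j).trans ?_
    rw [one_pow, ← pow_mul]
    have : 0 ≤ x ^ (2 * j) := by rw [pow_mul]; positivity
    gcongr
    · norm_num
    · omega
  have h2 := pow_mul_l2Sq_le_modeSq (by omega : p + 0 ≤ m) x u
  have h3 := pow_mul_l2Sq_le_modeSq h x u
  calc (1 + x ^ 2) ^ j * l2Sq (iteratedDeriv p u)
      ≤ 2 ^ m * (1 + x ^ (2 * j)) * l2Sq (iteratedDeriv p u) :=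
        mul_le_mul_of_nonneg_right h1 (l2Sq_nonneg _)
    _ = 2 ^ m * (x ^ (2 * 0) * l2Sq (iteratedDeriv p u) +
          x ^ (2 * j) * l2Sq (iteratedDeriv p u)) := by ring
    _ ≤ 2 ^ m * (modeSq m x u + modeSq m x u) := by gcongr
    _ = _ := by ring

lemma modeSq_le_of_forall {m : ℕ} {x M : ℝ} {u : ℝ → ℂ} (hM : 0 ≤ M)
    (h : ∀ p ≤ m, (1 + x ^ 2) ^ (m - p) * l2Sq (iteratedDeriv p u) ≤ M) :
    modeSq m x u ≤ (m + 1) ^ 2 * M := by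
  have hin : ∀ p ∈ Finset.range (m + 1), ∑ q ∈ Finset.range (m + 1 - p),
      x ^ (2 * q) * l2Sq (iteratedDeriv p u) ≤ (m + 1) * M := fun p hp => by
    have hp' := Finset.mem_range.1 hp
    have hle : ∀ q ∈ Finset.range (m + 1 - p),
        x ^ (2 * q) * l2Sq (iteratedDeriv p u) ≤ M := fun q hq => by
      have hq' := Finset.mem_range.1 hq
      refine le_trans (mul_le_mul_of_nonneg_right ?_ (l2Sq_nonneg _)) (h p (by omega))
      rw [pow_mul]
      calc (x ^ 2) ^ q ≤ (1 + x ^ 2) ^ q := by gcongr; linarith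
        _ ≤ (1 + x ^ 2) ^ (m - p) :=
          pow_le_pow_right₀ (by nlinarith [sq_nonneg x]) (by omega)
    refine (Finset.sum_le_card_nsmul _ _ _ hle).trans ?_
    rw [Finset.card_range, nsmul_eq_mul]
    have : ((m + 1 - p : ℕ) : ℝ) ≤ m + 1 := by exact_mod_cast Nat.sub_le _ _
    gcongr
  refine (Finset.sum_le_card_nsmul _ _ _ hin).trans_eq ?_
  rw [Finset.card_range, nsmul_eq_mul]
  push_cast
  ring

lemma hasDerivAt_of_contDiff_two {n : ℕ} {a : ℝ → ℂ} (ha : ContDiff ℝ (n + 2 : ℕ) a) :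
    (∀ t, HasDerivAt a (iteratedDeriv 1 a t) t) ∧
      (∀ t, HasDerivAt (iteratedDeriv 1 a) (iteratedDeriv 2 a t) t) ∧
      Continuous (iteratedDeriv 2 a) := by
  refine ⟨fun t => ?_, fun t => ?_, ha.continuous_iteratedDeriv 2 (by exact_mod_cast (by omega))⟩
  · rw [iteratedDeriv_one]
    exact (ha.differentiable (by simp) t).hasDerivAt
  · rw [iteratedDeriv_succ (n := 1)]
    exact (ha.differentiable_iteratedDeriv 1 (by exact_mod_cast (by omega)) t).hasDerivAt

/-- Boundedness of the Dirichlet Laplacian on a single Fourier mode. -/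
lemma mode_bounded {n : ℕ} {a : ℝ → ℂ} (ha : ContDiff ℝ (n + 2 : ℕ) a) (x : ℝ) :
    modeSq n x (fun t => -(iteratedDeriv 2 a t - (x:ℂ) ^ 2 * a t)) +
        (1 + x ^ 2) ^ (n + 1) * √(1 + x ^ 2) * (‖a 0‖ ^ 2 + ‖a 1‖ ^ 2) ≤
      (((n:ℝ) + 1) ^ 2 * (4 * 2 ^ (n + 3)) + 6 * 2 ^ (n + 3)) * modeSq (n + 2) x a := by
  obtain ⟨h1, h2, hc⟩ := hasDerivAt_of_contDiff_two ha
  set Y := modeSq (n + 2) x a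
  have hY : 0 ≤ Y := modeSq_nonneg _ _ _
  have hterm : ∀ {p j : ℕ}, p + j ≤ n + 2 →
      (1 + x ^ 2) ^ j * l2Sq (iteratedDeriv p a) ≤ 2 ^ (n + 3) * Y :=
    fun h => japanese_pow_mul_l2Sq_le_modeSq h x a
  have hcont : ∀ p ≤ n + 2, Continuous (iteratedDeriv p a) := fun p hp =>
    ha.continuous_iteratedDeriv p (by exact_mod_cast hp)
  have hmode : modeSq n x (fun t => -(iteratedDeriv 2 a t - (x:ℂ) ^ 2 * a t)) ≤
      ((n:ℝ) + 1) ^ 2 * (4 * 2 ^ (n + 3) * Y) := by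
    refine modeSq_le_of_forall (by positivity) fun p hp => ?_
    have hA := hcont p (by omega)
    have hB := hcont (p + 2) (by omega)
    have hD : iteratedDeriv p (fun t => -(iteratedDeriv 2 a t - (x:ℂ) ^ 2 * a t)) =
        fun t => -(iteratedDeriv (p + 2) a t - (x:ℂ) ^ 2 * iteratedDeriv p a t) := by
      funext t
      rw [iteratedDeriv_fun_neg, iteratedDeriv_helmholtz ha _ hp]
    rw [hD]
    have hle := l2Sq_le_of_norm_le (α := 1) (β := x ^ 2) hB hA
      (w := fun t => -(iteratedDeriv (p + 2) a t - (x:ℂ) ^ 2 * iteratedDeriv p a t))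
      (by fun_prop) (fun t _ => by
        rw [norm_neg]
        refine (norm_sub_le _ _).trans_eq ?_
        simp)
    have hx : (x ^ 2) ^ 2 ≤ (1 + x ^ 2) ^ 2 := by
      gcongr
      linarith
    have t1 := hterm (p := p + 2) (j := n - p) (by omega)
    have t2 := hterm (p := p) (j := n - p + 2) (by omega)
    have hl := l2Sq_nonneg (iteratedDeriv p a)
    calc _ ≤ (1 + x ^ 2) ^ (n - p) * (2 * 1 ^ 2 * l2Sq (iteratedDeriv (p + 2) a) +
            2 * (x ^ 2) ^ 2 * l2Sq (iteratedDeriv p a)) := by gcongr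
      _ ≤ (1 + x ^ 2) ^ (n - p) * (2 * 1 ^ 2 * l2Sq (iteratedDeriv (p + 2) a) +
            2 * (1 + x ^ 2) ^ 2 * l2Sq (iteratedDeriv p a)) := by gcongr
      _ = 2 * ((1 + x ^ 2) ^ (n - p) * l2Sq (iteratedDeriv (p + 2) a)) +
            2 * ((1 + x ^ 2) ^ (n - p + 2) * l2Sq (iteratedDeriv p a)) := by ring
      _ ≤ _ := by linarith
  have t0 := hterm (p := 0) (j := n + 2) (by omega)
  have t1 := hterm (p := 1) (j := n + 1) (by omega)
  rw [iteratedDeriv_zero] at t0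
  set y := 1 + x ^ 2 with hy
  have hy1 : 1 ≤ y := by rw [hy]; nlinarith [sq_nonneg x]
  set r := √y
  have hr2 : r ^ 2 = y := Real.sq_sqrt (by linarith)
  have hr1 : 1 ≤ r := Real.one_le_sqrt.2 hy1
  have hA := l2Sq_nonneg a
  have htr : ∀ z : ℝ, z ≤ (1 + r) * l2Sq a + r⁻¹ * l2Sq (iteratedDeriv 1 a) →
      y ^ (n + 1) * r * z ≤ 3 * 2 ^ (n + 3) * Y := fun z hz => by
    calc y ^ (n + 1) * r * z
        ≤ y ^ (n + 1) * r * ((1 + r) * l2Sq a + r⁻¹ * l2Sq (iteratedDeriv 1 a)) := by gcongr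
      _ ≤ y ^ (n + 1) * r * ((r + r) * l2Sq a + r⁻¹ * l2Sq (iteratedDeriv 1 a)) := by gcongr
      _ = 2 * (y ^ (n + 1) * r ^ 2 * l2Sq a) + y ^ (n + 1) * l2Sq (iteratedDeriv 1 a) := by
          field_simp
          ring
      _ = 2 * (y ^ (n + 2) * l2Sq a) + y ^ (n + 1) * l2Sq (iteratedDeriv 1 a) := by
          rw [hr2]; ring
      _ ≤ _ := by linarith
  have hc1 := hcont 1 (by omega)
  have tr0 := htr _ (by
    simpa using normSq_trace_le h1 hc1 (s := 1) (μ := r) (by simp) (by linarith))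
  have tr1 := htr _ (by
    simpa using normSq_trace_le h1 hc1 (s := 0) (μ := r) (by simp) (by linarith))
  linarith

/-- A-priori estimate of all derivatives on a single Fourier mode. -/
lemma mode_apriori {n : ℕ} {a : ℝ → ℂ} (ha : ContDiff ℝ (n + 2 : ℕ) a) (x : ℝ) :
    modeSq (n + 2) x a ≤ ((n:ℝ) + 3) ^ 2 * (4000 * 2 ^ (n + 1) * 4 ^ (n + 2)) *
      (modeSq n x (fun t => iteratedDeriv 2 a t - (x:ℂ) ^ 2 * a t) +
        (1 + x ^ 2) ^ (n + 1) * √(1 + x ^ 2) * (‖a 0‖ ^ 2 + ‖a 1‖ ^ 2)) := by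
  obtain ⟨h1, h2, hc⟩ := hasDerivAt_of_contDiff_two ha
  set f : ℝ → ℂ := fun t => iteratedDeriv 2 a t - (x:ℂ) ^ 2 * a t with hf
  have hterm : ∀ {p j : ℕ}, p + j ≤ n →
      (1 + x ^ 2) ^ j * l2Sq (iteratedDeriv p f) ≤ 2 ^ (n + 1) * modeSq n x f :=
    fun h => japanese_pow_mul_l2Sq_le_modeSq h x f
  have hap := dirichlet_apriori h1 h2 hc x
  have hcont : ∀ p ≤ n + 2, Continuous (iteratedDeriv p a) := fun p hp =>
    ha.continuous_iteratedDeriv p (by exact_mod_cast hp)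
  have hN : 0 ≤ modeSq n x f := modeSq_nonneg _ _ _
  set B := (1 + x ^ 2) ^ (n + 1) * √(1 + x ^ 2) * (‖a 0‖ ^ 2 + ‖a 1‖ ^ 2) with hB
  have hB0 : 0 ≤ B := by positivity
  have hone : (1:ℝ) ≤ 2 ^ (n + 1) := one_le_pow₀ (by norm_num)
  have hbase : (1 + x ^ 2) ^ n * (4000 * (l2Sq f +
      (1 + x ^ 2) * √(1 + x ^ 2) * (‖a 0‖ ^ 2 + ‖a 1‖ ^ 2))) ≤
      4000 * 2 ^ (n + 1) * (modeSq n x f + B) := by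
    have h0 := hterm (p := 0) (j := n) (by omega)
    rw [iteratedDeriv_zero] at h0
    calc _ = 4000 * ((1 + x ^ 2) ^ n * l2Sq f + B) := by rw [hB]; ring
      _ ≤ 4000 * (2 ^ (n + 1) * modeSq n x f + 2 ^ (n + 1) * B) := by
          gcongr
          exact le_mul_of_one_le_left hB0 hone
      _ = _ := by ring
  have hall : ∀ p, p ≤ n + 2 → (1 + x ^ 2) ^ (n + 2 - p) * l2Sq (iteratedDeriv p a) ≤
      4000 * 2 ^ (n + 1) * 4 ^ p * (modeSq n x f + B) := by
    intro p
    induction p using Nat.twoStepInduction with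
    | zero =>
      intro _
      rw [iteratedDeriv_zero, pow_zero, mul_one]
      refine le_trans ?_ hbase
      calc _ = (1 + x ^ 2) ^ n * ((1 + x ^ 2) ^ 2 * l2Sq a) := by
            rw [Nat.sub_zero]; ring
        _ ≤ _ := mul_le_mul_of_nonneg_left hap.1 (by positivity)
    | one =>
      intro _
      have : (1 + x ^ 2) ^ (n + 2 - 1) * l2Sq (iteratedDeriv 1 a) ≤
          4000 * 2 ^ (n + 1) * (modeSq n x f + B) := by
        refine le_trans ?_ hbase
        calc _ = (1 + x ^ 2) ^ n * ((1 + x ^ 2) * l2Sq (iteratedDeriv 1 a)) := by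
              rw [show n + 2 - 1 = n + 1 by omega]; ring
          _ ≤ _ := mul_le_mul_of_nonneg_left hap.2 (by positivity)
      have hpos : 0 ≤ 4000 * 2 ^ (n + 1) * (modeSq n x f + B) := by positivity
      linarith
    | more p ih _ =>
      intro hp
      have hA := hcont p (by omega)
      have hAA := hcont (p + 2) hp
      have hD := iteratedDeriv_helmholtz ha ((x:ℂ) ^ 2) (by omega : p ≤ n)
      have hF : Continuous (iteratedDeriv p f) := by
        rw [hf, hD]
        fun_prop
      have hle := l2Sq_le_of_norm_le (α := x ^ 2) (β := 1) hA hF hAA (fun t _ => by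
        rw [hf, hD]
        have := norm_add_le ((x:ℂ) ^ 2 * iteratedDeriv p a t)
          (iteratedDeriv (p + 2) a t - (x:ℂ) ^ 2 * iteratedDeriv p a t)
        rw [add_sub_cancel] at this
        simpa using this)
      have hx : (x ^ 2) ^ 2 ≤ (1 + x ^ 2) ^ 2 := by
        gcongr
        linarith
      have t1 := ih (by omega)
      have t2 := hterm (p := p) (j := n - p) (by omega)
      have hl := l2Sq_nonneg (iteratedDeriv p a)
      have he : n + 2 - (p + 2) = n - p := by omega
      have he' : n + 2 - p = n - p + 2 := by omega
      rw [he'] at t1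
      have h4 : (1:ℝ) ≤ 4 ^ p := one_le_pow₀ (by norm_num)
      have hmono : 2 ^ (n + 1) * modeSq n x f ≤
          4000 * 2 ^ (n + 1) * 4 ^ p * (modeSq n x f + B) := by
        have e1 : (2:ℝ) ^ (n + 1) ≤ 4000 * 2 ^ (n + 1) * 4 ^ p := by nlinarith
        have e2 : modeSq n x f ≤ modeSq n x f + B := by linarith
        gcongr
      have hnn : 0 ≤ 4000 * 2 ^ (n + 1) * 4 ^ p * (modeSq n x f + B) := by positivity
      calc (1 + x ^ 2) ^ (n + 2 - (p + 2)) * l2Sq (iteratedDeriv (p + 2) a)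
          ≤ (1 + x ^ 2) ^ (n - p) * (2 * (x ^ 2) ^ 2 * l2Sq (iteratedDeriv p a) +
              2 * 1 ^ 2 * l2Sq (iteratedDeriv p f)) := by rw [he]; gcongr
        _ ≤ (1 + x ^ 2) ^ (n - p) * (2 * (1 + x ^ 2) ^ 2 * l2Sq (iteratedDeriv p a) +
              2 * 1 ^ 2 * l2Sq (iteratedDeriv p f)) := by gcongr
        _ = 2 * ((1 + x ^ 2) ^ (n - p + 2) * l2Sq (iteratedDeriv p a)) +
              2 * ((1 + x ^ 2) ^ (n - p) * l2Sq (iteratedDeriv p f)) := by ring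
        _ ≤ 4 * (4000 * 2 ^ (n + 1) * 4 ^ p * (modeSq n x f + B)) := by linarith
        _ ≤ 16 * (4000 * 2 ^ (n + 1) * 4 ^ p * (modeSq n x f + B)) := by linarith
        _ = _ := by ring
  have := modeSq_le_of_forall (m := n + 2) (x := x) (u := a)
    (M := 4000 * 2 ^ (n + 1) * 4 ^ (n + 2) * (modeSq n x f + B)) (by positivity) fun p hp => by
      refine (hall p hp).trans ?_
      gcongr
      norm_num
  refine this.trans_eq ?_
  push_cast
  ring

lemma lintegral_normSq_eq {u : ℝ → ℂ} (hu : Continuous u) :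
    ∫⁻ t in Set.Icc (0:ℝ) 1, (‖u t‖₊ : ℝ≥0∞) ^ 2 = ENNReal.ofReal (l2Sq u) := by
  rw [l2Sq, integral_of_le zero_le_one, ← integral_Icc_eq_integral_Ioc,
    ofReal_integral_eq_lintegral_ofReal]
  · refine lintegral_congr fun t => ?_
    rw [ENNReal.ofReal_pow (norm_nonneg _), ofReal_norm, enorm_eq_nnnorm]
  · exact (Continuous.continuousOn (by fun_prop)).integrableOn_Icc
  · exact ae_of_all _ fun t => by positivity

lemma YcSq_eq_tsum {σ : ℝ} {m : ℕ} {a : ℤ → ℝ → ℂ} (ha : ∀ k, ContDiff ℝ m (a k)) :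
    YcSq σ m a = ∑' k : ℤ, ENNReal.ofReal (Real.exp (2 * σ * |(k:ℝ)|) * modeSq m k (a k)) := by
  have hnn : ∀ (k : ℤ) (p q : ℕ),
      0 ≤ Real.exp (2 * σ * |(k:ℝ)|) * ((k:ℝ) ^ (2 * q) * l2Sq (iteratedDeriv p (a k))) :=
    fun k p q => mul_nonneg (Real.exp_pos _).le
      (mul_nonneg (by rw [pow_mul]; positivity) (l2Sq_nonneg _))
  have hk : ∀ k : ℤ, ENNReal.ofReal (Real.exp (2 * σ * |(k:ℝ)|) * modeSq m k (a k)) =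
      ∑ p ∈ Finset.range (m + 1), ∑ q ∈ Finset.range (m + 1 - p),
        ENNReal.ofReal ((k:ℝ) ^ (2 * q) * Real.exp (2 * σ * |(k:ℝ)|)) *
          ∫⁻ t in Set.Icc (0:ℝ) 1, (‖iteratedDeriv p (a k) t‖₊ : ℝ≥0∞) ^ 2 := fun k => by
    simp only [modeSq, Finset.mul_sum]
    rw [ENNReal.ofReal_sum_of_nonneg fun p _ => Finset.sum_nonneg fun q _ => hnn k p q]
    refine Finset.sum_congr rfl fun p hp => ?_
    rw [ENNReal.ofReal_sum_of_nonneg fun q _ => hnn k p q]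
    refine Finset.sum_congr rfl fun q _ => ?_
    have hp' : p ≤ m := by have := Finset.mem_range.1 hp; omega
    rw [lintegral_normSq_eq ((ha k).continuous_iteratedDeriv p (by exact_mod_cast hp')),
      ← ENNReal.ofReal_mul (mul_nonneg (by rw [pow_mul]; positivity) (Real.exp_pos _).le)]
    congr 1
    ring
  simp only [hk, YcSq]
  rw [Summable.tsum_finsetSum fun _ _ => ENNReal.summable]
  refine Finset.sum_congr rfl fun p _ => ?_
  rw [Summable.tsum_finsetSum fun _ _ => ENNReal.summable]

lemma XSq_eq_tsum (σ : ℝ) (n : ℕ) (b : ℤ → ℂ) :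
    XSq σ (((n + 2 : ℕ) : ℝ) - 1 / 2) b = ∑' k : ℤ, ENNReal.ofReal (Real.exp (2 * σ * |(k:ℝ)|) *
      ((1 + (k:ℝ) ^ 2) ^ (n + 1) * √(1 + (k:ℝ) ^ 2) * ‖b k‖ ^ 2)) := by
  refine tsum_congr fun k => ?_
  have hy : 0 < 1 + (k:ℝ) ^ 2 := by positivity
  have hpow : (1 + (k:ℝ) ^ 2) ^ (((n + 2 : ℕ) : ℝ) - 1 / 2) =
      (1 + (k:ℝ) ^ 2) ^ (n + 1) * √(1 + (k:ℝ) ^ 2) := by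
    rw [Real.sqrt_eq_rpow, ← Real.rpow_natCast _ (n + 1), ← Real.rpow_add hy]
    congr 1
    push_cast
    ring
  rw [hpow, ← enorm_eq_nnnorm, ← ofReal_norm, ← ENNReal.ofReal_pow (norm_nonneg _),
    ← ENNReal.ofReal_mul (by positivity)]
  congr 1
  ring

/-- The squared norm of data `(f, b, c)` as a single sum over the Fourier modes. -/
lemma data_norm_eq_tsum {σ : ℝ} {n : ℕ} {f : ℤ → ℝ → ℂ} (hf : ∀ k, ContDiff ℝ n (f k))
    (b c : ℤ → ℂ) :
    YcSq σ n f + XSq σ (((n + 2 : ℕ) : ℝ) - 1 / 2) b + XSq σ (((n + 2 : ℕ) : ℝ) - 1 / 2) c =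
      ∑' k : ℤ, ENNReal.ofReal (Real.exp (2 * σ * |(k:ℝ)|) * (modeSq n k (f k) +
        (1 + (k:ℝ) ^ 2) ^ (n + 1) * √(1 + (k:ℝ) ^ 2) * (‖b k‖ ^ 2 + ‖c k‖ ^ 2))) := by
  rw [YcSq_eq_tsum hf, XSq_eq_tsum, XSq_eq_tsum, ← ENNReal.tsum_add, ← ENNReal.tsum_add]
  refine tsum_congr fun k => ?_
  have := modeSq_nonneg n k (f k)
  rw [← ENNReal.ofReal_add (by positivity) (by positivity),
    ← ENNReal.ofReal_add (by positivity) (by positivity)]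
  congr 1
  ring

lemma tsum_ofReal_exp_mul_le {σ C D : ℝ} (hC : 0 ≤ C) (hCD : C ≤ D) {A B : ℤ → ℝ}
    (hB : ∀ k, 0 ≤ B k) (h : ∀ k, A k ≤ C * B k) :
    ∑' k : ℤ, ENNReal.ofReal (Real.exp (2 * σ * |(k:ℝ)|) * A k) ≤
      ENNReal.ofReal D * ∑' k : ℤ, ENNReal.ofReal (Real.exp (2 * σ * |(k:ℝ)|) * B k) := by
  rw [← ENNReal.tsum_mul_left]
  refine ENNReal.tsum_le_tsum fun k => ?_
  rw [← ENNReal.ofReal_mul (hC.trans hCD)]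
  refine ENNReal.ofReal_le_ofReal ?_
  calc Real.exp (2 * σ * |(k:ℝ)|) * A k ≤ Real.exp (2 * σ * |(k:ℝ)|) * (D * B k) :=
        mul_le_mul_of_nonneg_left ((h k).trans (mul_le_mul_of_nonneg_right hCD (hB k)))
          (Real.exp_pos _).le
    _ = _ := by ring

/-- Solutions of `a'' - x² a = f` on `[0,1]` are determined by their boundary values. -/
lemma dirichlet_unique {n : ℕ} {a a' : ℝ → ℂ} (ha : ContDiff ℝ (n + 2 : ℕ) a)
    (ha' : ContDiff ℝ (n + 2 : ℕ) a') (x : ℝ)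
    (h : ∀ t ∈ Icc (0:ℝ) 1, iteratedDeriv 2 a' t - (x:ℂ) ^ 2 * a' t =
      iteratedDeriv 2 a t - (x:ℂ) ^ 2 * a t) (h0 : a' 0 = a 0) (h1 : a' 1 = a 1) :
    EqOn a' a (Icc 0 1) := by
  obtain ⟨d1, d2, dc⟩ := hasDerivAt_of_contDiff_two ha
  obtain ⟨d1', d2', dc'⟩ := hasDerivAt_of_contDiff_two ha'
  have hE := (dirichlet_energy (fun t => (d1' t).sub (d1 t)) (fun t => (d2' t).sub (d2 t))
    (dc'.sub dc) x (by simp [h0]) (by simp [h1])).1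
  have hz : l2Sq (fun t => (iteratedDeriv 2 a' t - iteratedDeriv 2 a t) -
      (x:ℂ) ^ 2 * (a' t - a t)) = 0 := by
    rw [l2Sq_congr (v := fun _ => 0) fun t ht => by linear_combination h t ht]
    simp [l2Sq]
  have hle : l2Sq (a' - a) ≤ 0 := by
    have hE' : (1 + x ^ 2) ^ 2 * l2Sq (a' - a) ≤ 0 := hE.trans (by
      simp only [Pi.sub_apply]; rw [hz, mul_zero])
    exact nonpos_of_mul_nonpos_right hE' (by positivity)
  intro t ht
  exact sub_eq_zero.1 (eqOn_zero_of_l2Sq_nonpos (ha'.continuous.sub ha.continuous) hle ht)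

theorem dirichlet_laplacian_isomorphism (σ : ℝ) (hσ : 0 < σ) (m : ℕ) (hm : 2 ≤ m) :
    ∃ C > (0:ℝ),
      -- boundedness of a ↦ (−Δa, a(·,0), a(·,1))
      (∀ a : ℤ → ℝ → ℂ, (∀ k, ContDiff ℝ m (a k)) → YcSq σ m a < ⊤ →
        YcSq σ (m-2) (fun k t => -(iteratedDeriv 2 (a k) t - (k:ℂ)^2 * a k t)) +
          XSq σ ((m:ℝ) - 1/2) (fun k => a k 0) +
          XSq σ ((m:ℝ) - 1/2) (fun k => a k 1) ≤ ENNReal.ofReal C * YcSq σ m a) ∧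
      -- existence, uniqueness and the a-priori estimate for the Dirichlet problem
      (∀ (f : ℤ → ℝ → ℂ) (b c : ℤ → ℂ),
        (∀ k, ContDiff ℝ (m-2) (f k)) → YcSq σ (m-2) f < ⊤ →
        XSq σ ((m:ℝ) - 1/2) b < ⊤ → XSq σ ((m:ℝ) - 1/2) c < ⊤ →
        ∃ a : ℤ → ℝ → ℂ,
          (∀ k, ContDiff ℝ m (a k)) ∧
          (∀ k, ∀ t ∈ Set.Icc (0:ℝ) 1,
            iteratedDeriv 2 (a k) t - (k:ℂ)^2 * a k t = f k t) ∧
          (∀ k, a k 0 = b k ∧ a k 1 = c k) ∧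
          YcSq σ m a ≤ ENNReal.ofReal C *
            (YcSq σ (m-2) f + XSq σ ((m:ℝ) - 1/2) b + XSq σ ((m:ℝ) - 1/2) c) ∧
          -- uniqueness
          (∀ a' : ℤ → ℝ → ℂ, (∀ k, ContDiff ℝ m (a' k)) → YcSq σ m a' < ⊤ →
            (∀ k, ∀ t ∈ Set.Icc (0:ℝ) 1,
              iteratedDeriv 2 (a' k) t - (k:ℂ)^2 * a' k t = f k t) →
            (∀ k, a' k 0 = b k ∧ a' k 1 = c k) →
            ∀ k, Set.EqOn (a' k) (a k) (Set.Icc (0:ℝ) 1))) := by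
  obtain ⟨n, rfl⟩ : ∃ n, m = n + 2 := ⟨m - 2, by omega⟩
  simp only [Nat.add_sub_cancel]
  set C₁ : ℝ := ((n:ℝ) + 1) ^ 2 * (4 * 2 ^ (n + 3)) + 6 * 2 ^ (n + 3)
  set C₂ : ℝ := ((n:ℝ) + 3) ^ 2 * (4000 * 2 ^ (n + 1) * 4 ^ (n + 2))
  have hC₁0 : 0 < C₁ := by positivity
  have hC₂0 : 0 < C₂ := by positivity
  refine ⟨C₁ + C₂, by positivity, fun a ha _ => ?_, fun f b c hf _ _ _ => ?_⟩
  · have hL : ∀ k : ℤ, ContDiff ℝ n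
        (fun t => -(iteratedDeriv 2 (a k) t - (k:ℂ) ^ 2 * a k t)) := fun k => by
      have h2 : ContDiff ℝ n (iteratedDeriv 2 (a k)) := by
        rw [iteratedDeriv_eq_iterate]
        exact ContDiff.iterate_deriv' n 2 (ha k)
      exact (h2.sub (contDiff_const.mul ((ha k).of_le (by exact_mod_cast (by omega))))).neg
    rw [data_norm_eq_tsum hL, YcSq_eq_tsum ha]
    refine tsum_ofReal_exp_mul_le hC₁0.le (by linarith) (fun k => modeSq_nonneg _ _ _) fun k => ?_
    have := mode_bounded (ha k) (k:ℝ)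
    rwa [Complex.ofReal_intCast] at this
  · have hsub : (((n + 2 : ℕ) : WithTop ℕ∞) - 2) = n := by norm_cast
    rw [hsub] at hf
    choose a v ha hav hvw h0 h1 using fun k : ℤ => exists_dirichlet_solution (hf k) k (b k) (c k)
    have hode : ∀ k t, iteratedDeriv 2 (a k) t - (k:ℂ) ^ 2 * a k t = f k t := fun k t => by
      have e1 : deriv (a k) = v k := funext fun t => (hav k t).deriv
      rw [iteratedDeriv_succ, iteratedDeriv_one, e1, (hvw k t).deriv, Complex.ofReal_intCast]
      ring
    refine ⟨a, ha, fun k t _ => hode k t, fun k => ⟨h0 k, h1 k⟩, ?_, fun a' ha' _ hode' hbc k => ?_⟩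
    · rw [data_norm_eq_tsum hf, YcSq_eq_tsum ha]
      refine tsum_ofReal_exp_mul_le hC₂0.le (by linarith) (fun k => ?_) fun k => ?_
      · have := modeSq_nonneg n k (f k)
        positivity
      · have := mode_apriori (ha k) (k:ℝ)
        rwa [Complex.ofReal_intCast, funext (hode k), h0, h1] at this
    · refine dirichlet_unique (ha k) (ha' k) k (fun t ht => ?_) ?_ ?_
      · rw [Complex.ofReal_intCast, hode, hode' k t ht]
      · rw [(hbc k).1, h0]
      · rw [(hbc k).2, h1]
end
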